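/- arXiv:2405.05366 — 14 statements merged into one kernel-verified Lean document; each statement's English description precedes it below -/
import Mathlib

section
/- Let a > 0 and let φ : ℝ → ℝ be continuous, bounded, and possess finite limits at +∞ and at −∞. Then the functions x ↦ n·a·∫_{(−∞,x]} e^{−n·a·(x−y)}·φ(y) dy converge to φ uniformly on ℝ as n → ∞; that is, for every ε > 0 there exists N such that for every natural number n ≥ N and every x ∈ ℝ one has |n·a·∫_{(−∞,x]} e^{−n·a·(x−y)}·φ(y) dy − φ(x)| ≤ ε. -/
open MeasureTheory Filter

lemma aux_uc (φ : ℝ → ℝ) (hcont : Continuous φ)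
    (hlim_top : ∃ Lp : ℝ, Tendsto φ atTop (nhds Lp))
    (hlim_bot : ∃ Lm : ℝ, Tendsto φ atBot (nhds Lm)) (ε : ℝ) (hε : 0 < ε) :
    ∃ δ > 0, ∀ x y : ℝ, |x - y| < δ → |φ y - φ x| ≤ ε := by
  obtain ⟨Lp, hp⟩ := hlim_top
  obtain ⟨Lm, hm⟩ := hlim_bot
  obtain ⟨A, hA⟩ := eventually_atTop.1 (Metric.tendsto_nhds.1 hp (ε/2) (by positivity))
  obtain ⟨B, hB⟩ := eventually_atBot.1 (Metric.tendsto_nhds.1 hm (ε/2) (by positivity))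
  have hu := (isCompact_Icc (a := B - 1) (b := A + 1)).uniformContinuousOn_of_continuous
    hcont.continuousOn
  obtain ⟨δ, hδ, h⟩ := Metric.uniformContinuousOn_iff.1 hu ε hε
  refine ⟨min δ 1, by positivity, fun x y hxy => ?_⟩
  obtain ⟨h1, h2⟩ := lt_min_iff.1 hxy
  simp only [Real.dist_eq] at *
  rw [abs_lt] at h2
  by_cases hA' : A ≤ x ∧ A ≤ y
  · have e1 := abs_lt.1 (hA x hA'.1)
    have e2 := abs_lt.1 (hA y hA'.2)
    rw [abs_le]; constructor <;> linarith
  by_cases hB' : x ≤ B ∧ y ≤ B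
  · have e1 := abs_lt.1 (hB x hB'.1)
    have e2 := abs_lt.1 (hB y hB'.2)
    rw [abs_le]; constructor <;> linarith
  have := h y (by constructor <;> grind) x (by constructor <;> grind) (by rwa [abs_sub_comm])
  exact this.le

lemma aux_int (c : ℝ) (hc : 0 < c) (x : ℝ) :
    IntegrableOn (fun y => Real.exp (-c * (x - y))) (Set.Iic x) ∧
    ∫ y in Set.Iic x, Real.exp (-c * (x - y)) = 1 / c := by
  have e : (fun y => Real.exp (-c * (x - y))) =
      fun y => Real.exp (-c * x) * Real.exp (c * y) := by
    ext y; rw [← Real.exp_add]; congr 1; ring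
  rw [e]
  refine ⟨(integrableOn_exp_mul_Iic hc x).const_mul _, ?_⟩
  rw [integral_const_mul, integral_exp_mul_Iic hc, mul_div_assoc', ← Real.exp_add]
  simp

theorem dirac_convolution_Iic_uniform
    (a : ℝ) (ha : 0 < a) (φ : ℝ → ℝ)
    (hcont : Continuous φ)
    (hbdd : ∃ M : ℝ, ∀ x : ℝ, |φ x| ≤ M)
    (hlim_top : ∃ Lp : ℝ, Tendsto φ atTop (nhds Lp))
    (hlim_bot : ∃ Lm : ℝ, Tendsto φ atBot (nhds Lm)) :
    ∀ ε > 0, ∃ N : ℕ, ∀ n : ℕ, N ≤ n → ∀ x : ℝ,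
      |(n : ℝ) * a * (∫ y in Set.Iic x, Real.exp (-((n : ℝ) * a) * (x - y)) * φ y)
        - φ x| ≤ ε := by
  intro ε hε
  obtain ⟨M, hM⟩ := hbdd
  have hM0 : 0 ≤ M := (abs_nonneg _).trans (hM 0)
  obtain ⟨δ, hδ, hu⟩ := aux_uc φ hcont hlim_top hlim_bot (ε/2) (by positivity)
  obtain ⟨K, hK⟩ : ∃ K, K = 2 * M / δ := ⟨_, rfl⟩
  have hK0 : 0 ≤ K := by rw [hK]; positivity
  have hKδ : K * δ = 2 * M := by rw [hK]; field_simp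
  obtain ⟨N, hN⟩ := exists_nat_gt (8 * K / (ε * a))
  refine ⟨N + 1, fun n hn x => ?_⟩
  have hn' : (N : ℝ) + 1 ≤ n := by exact_mod_cast hn
  have hn0 : (0 : ℝ) < n := by have := N.cast_nonneg (α := ℝ); linarith
  have hnc : 8 * K < n * a * ε := by
    rw [div_lt_iff₀ (by positivity)] at hN
    have : (N : ℝ) * (ε * a) ≤ n * (ε * a) := by gcongr; linarith
    linarith
  have hc : 0 < (n : ℝ) * a := by positivity
  generalize (n : ℝ) * a = c at *
  obtain ⟨i1, v1⟩ := aux_int c hc x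
  obtain ⟨i2, v2⟩ := aux_int (c / 2) (by positivity) x
  have iφ : IntegrableOn (fun y => Real.exp (-c * (x - y)) * φ y) (Set.Iic x) :=
    Integrable.mul_bdd (c := M) i1 hcont.aestronglyMeasurable (ae_of_all _ hM)
  have key : ∀ y ∈ Set.Iic x, ‖Real.exp (-c * (x - y)) * φ y - Real.exp (-c * (x - y)) * φ x‖ ≤
      ε / 2 * Real.exp (-c * (x - y)) + K * (2 / c) * Real.exp (-(c / 2) * (x - y)) := by
    intro y hy
    have ht : 0 ≤ x - y := sub_nonneg.2 hy
    have b1 : |φ y - φ x| ≤ ε / 2 + K * (x - y) := by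
      by_cases hd : |x - y| < δ
      · have := hu x y hd
        have : 0 ≤ K * (x - y) := by positivity
        linarith
      · rw [abs_of_nonneg ht, not_lt] at hd
        have h1 := abs_le.1 (hM x)
        have h2 := abs_le.1 (hM y)
        have : K * δ ≤ K * (x - y) := by gcongr
        rw [abs_le]; constructor <;> linarith
    have b2 : x - y ≤ 2 / c * Real.exp (c / 2 * (x - y)) := by
      have := Real.add_one_le_exp (c / 2 * (x - y))
      calc x - y = 2 / c * (c / 2 * (x - y)) := by field_simp
        _ ≤ _ := by gcongr; linarith
    have e : Real.exp (-(c / 2) * (x - y)) =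
        Real.exp (-c * (x - y)) * Real.exp (c / 2 * (x - y)) := by
      rw [← Real.exp_add]; congr 1; ring
    rw [← mul_sub, norm_mul, Real.norm_eq_abs, Real.norm_eq_abs, Real.abs_exp, e]
    calc _ ≤ Real.exp (-c * (x - y)) * (ε / 2 + K * (2 / c * Real.exp (c / 2 * (x - y)))) := by
          gcongr
          exact b1.trans (by gcongr)
      _ = _ := by ring
  have hb := norm_integral_le_of_norm_le (μ := volume.restrict (Set.Iic x))
    ((i1.const_mul (ε / 2)).add (i2.const_mul (K * (2 / c))))
    ((ae_restrict_iff' measurableSet_Iic).2 (ae_of_all _ key))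
  simp only [Pi.add_apply] at hb
  rw [integral_sub iφ (i1.mul_const _), integral_add (i1.const_mul _) (i2.const_mul _),
    integral_mul_const, integral_const_mul, integral_const_mul, v1, v2, Real.norm_eq_abs] at hb
  generalize (∫ y in Set.Iic x, Real.exp (-c * (x - y)) * φ y) = I at *
  have : c * I - φ x = c * (I - 1 / c * φ x) := by field_simp
  rw [this, abs_mul, abs_of_pos hc]
  calc _ ≤ c * (ε / 2 * (1 / c) + K * (2 / c) * (1 / (c / 2))) := by gcongr
    _ = ε / 2 + 4 * K / c := by field_simp; ring
    _ ≤ ε / 2 + ε / 2 := by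
        have : 4 * K / c ≤ ε / 2 := by rw [div_le_iff₀ hc]; linarith
        linarith
    _ = ε := by ring
end

section
/- Let a > 0 and let φ : ℝ → ℝ be continuous, bounded, and possess finite limits at +∞ and at −∞. Then the functions x ↦ n·a·∫_{[x,∞)} e^{n·a·(x−y)}·φ(y) dy converge to φ uniformly on ℝ as n → ∞; that is, for every ε > 0 there exists N such that for every natural number n ≥ N and every x ∈ ℝ one has |n·a·∫_{[x,∞)} e^{n·a·(x−y)}·φ(y) dy − φ(x)| ≤ ε. -/
open MeasureTheory Filter

lemma aux_uc_s1 (φ : ℝ → ℝ) (hcont : Continuous φ) (Lp Lm : ℝ)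
    (hp : Tendsto φ atTop (nhds Lp)) (hm : Tendsto φ atBot (nhds Lm)) :
    UniformContinuous φ := by
  have hcl : UniformContinuous (fun x : ℝ => max 0 (min x 1)) := by
    have : LipschitzWith 1 (fun x : ℝ => max 0 (min x 1)) :=
      (LipschitzWith.id.min_const 1).const_max 0
    exact this.uniformContinuous
  have hg : UniformContinuous (fun x : ℝ => Lm + (Lp - Lm) * max 0 (min x 1)) :=
    uniformContinuous_const.add (hcl.const_mul' (Lp - Lm))
  have h : UniformContinuous (fun x => φ x - (Lm + (Lp - Lm) * max 0 (min x 1))) := by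
    apply Continuous.uniformContinuous_of_tendsto_cocompact (x := 0) (hcont.sub hg.continuous)
    rw [cocompact_eq_atBot_atTop]
    apply Tendsto.sup
    · have : Tendsto (fun x => φ x - Lm) atBot (nhds 0) := by
        simpa using hm.sub_const Lm
      refine this.congr' ?_
      filter_upwards [eventually_le_atBot 0] with x hx
      simp only [Pi.sub_apply]
      rw [min_eq_left (by linarith), max_eq_left hx]; ring
    · have : Tendsto (fun x => φ x - Lp) atTop (nhds 0) := by
        simpa using hp.sub_const Lp
      refine this.congr' ?_
      filter_upwards [eventually_ge_atTop 1] with x hx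
      simp only [Pi.sub_apply]
      rw [min_eq_right hx, max_eq_right (by norm_num)]; ring
  simpa using! h.add hg

lemma aux_exp (k : ℝ) (hk : 0 < k) (x : ℝ) :
    IntegrableOn (fun y => Real.exp (k * (x - y))) (Set.Ioi x) ∧
    ∫ y in Set.Ioi x, Real.exp (k * (x - y)) = 1 / k := by
  have e : (fun y => Real.exp (k * (x - y))) =
      fun y => Real.exp (k * x) * Real.exp (-k * y) := by
    ext y; rw [← Real.exp_add]; congr 1; ring
  rw [e]
  refine ⟨(integrableOn_exp_mul_Ioi (by linarith) x).const_mul _, ?_⟩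
  rw [integral_const_mul, integral_exp_mul_Ioi (by linarith), neg_div_neg_eq, ← mul_div_assoc,
    ← Real.exp_add]
  simp

theorem dirac_convolution_Ici_uniform
    (a : ℝ) (ha : 0 < a) (φ : ℝ → ℝ)
    (hcont : Continuous φ)
    (hbdd : ∃ M : ℝ, ∀ x : ℝ, |φ x| ≤ M)
    (hlim_top : ∃ Lp : ℝ, Tendsto φ atTop (nhds Lp))
    (hlim_bot : ∃ Lm : ℝ, Tendsto φ atBot (nhds Lm)) :
    ∀ ε > 0, ∃ N : ℕ, ∀ n : ℕ, N ≤ n → ∀ x : ℝ,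
      |(n : ℝ) * a * (∫ y in Set.Ici x, Real.exp ((n : ℝ) * a * (x - y)) * φ y)
        - φ x| ≤ ε := by
  intro ε hε
  obtain ⟨M, hM⟩ := hbdd
  obtain ⟨Lp, hp⟩ := hlim_top
  obtain ⟨Lm, hm⟩ := hlim_bot
  have hM0 : 0 ≤ M := (abs_nonneg _).trans (hM 0)
  obtain ⟨δ, hδ, hd⟩ := Metric.uniformContinuous_iff.1 (aux_uc_s1 φ hcont Lp Lm hp hm) (ε / 2)
    (by linarith)
  have hk : Tendsto (fun n : ℕ => (n : ℝ) * a) atTop atTop :=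
    tendsto_natCast_atTop_atTop.atTop_mul_const ha
  have hlim : Tendsto (fun n : ℕ => 4 * M * Real.exp (-((n : ℝ) * a * (δ / 2)))) atTop
      (nhds 0) := by
    simpa using (Real.tendsto_exp_neg_atTop_nhds_zero.comp
      (hk.atTop_mul_const (half_pos hδ))).const_mul (4 * M)
  obtain ⟨N, hN⟩ := eventually_atTop.1
    ((hk.eventually_gt_atTop 0).and (hlim.eventually_lt_const (half_pos hε)))
  refine ⟨N, fun n hn x => ?_⟩
  obtain ⟨hk0, hs⟩ := hN n hn
  generalize (n : ℝ) * a = k at hk0 hs ⊢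
  rw [integral_Ici_eq_integral_Ioi]
  obtain ⟨i1, e1⟩ := aux_exp k hk0 x
  obtain ⟨i2, e2⟩ := aux_exp (k / 2) (half_pos hk0) x
  have iφ : IntegrableOn (fun y => Real.exp (k * (x - y)) * φ y) (Set.Ioi x) :=
    Integrable.mul_bdd (c := M) i1 hcont.aestronglyMeasurable (Eventually.of_forall hM)
  have key : k * (∫ y in Set.Ioi x, Real.exp (k * (x - y)) * φ y) - φ x =
      k * ∫ y in Set.Ioi x, (Real.exp (k * (x - y)) * φ y - Real.exp (k * (x - y)) * φ x) := by
    rw [integral_sub iφ (i1.mul_const _), integral_mul_const, e1]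
    field_simp
  have hb : ‖∫ y in Set.Ioi x, (Real.exp (k * (x - y)) * φ y - Real.exp (k * (x - y)) * φ x)‖ ≤
      ∫ y in Set.Ioi x, (ε / 2 * Real.exp (k * (x - y)) +
        2 * M * Real.exp (-(k * (δ / 2))) * Real.exp (k / 2 * (x - y))) := by
    apply norm_integral_le_of_norm_le ((i1.const_mul _).add (i2.const_mul _))
    filter_upwards [ae_restrict_mem measurableSet_Ioi] with y hy
    have hy : x < y := hy
    simp only [Pi.add_apply]
    rw [← mul_sub, norm_mul, Real.norm_eq_abs, Real.abs_exp, Real.norm_eq_abs]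
    have p1 := Real.exp_pos (k * (x - y))
    rcases lt_or_ge (y - x) δ with h | h
    · have h1 : |φ y - φ x| < ε / 2 := by
        apply hd
        rw [Real.dist_eq, abs_of_pos (by linarith)]; exact h
      have : 0 ≤ 2 * M * Real.exp (-(k * (δ / 2))) * Real.exp (k / 2 * (x - y)) := by positivity
      nlinarith
    · have h1 : |φ y - φ x| ≤ 2 * M := by
        have := abs_sub (φ y) (φ x)
        linarith [hM x, hM y]
      have h2 : Real.exp (k * (x - y)) ≤
          Real.exp (-(k * (δ / 2))) * Real.exp (k / 2 * (x - y)) := by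
        rw [← Real.exp_add]
        apply Real.exp_le_exp.2
        nlinarith
      have h3 := mul_le_mul h2 h1 (abs_nonneg _) (by positivity)
      have : 0 ≤ ε / 2 * Real.exp (k * (x - y)) := by positivity
      linarith
  rw [integral_add (i1.const_mul _) (i2.const_mul _), integral_const_mul, integral_const_mul,
    e1, e2] at hb
  rw [key, abs_mul, abs_of_pos hk0]
  refine (mul_le_mul_of_nonneg_left hb hk0.le).trans ?_
  have : k * (ε / 2 * (1 / k) + 2 * M * Real.exp (-(k * (δ / 2))) * (1 / (k / 2))) =
      ε / 2 + 4 * M * Real.exp (-(k * (δ / 2))) := by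
    field_simp
    ring
  linarith
end

section
/- Let α, β ≥ 0 with α + β > 0 and let f : ℝ → ℝ be continuous, bounded, and possess finite limits at +∞ and at −∞. Then Eℓ^so[nα,nβ]f converges to Eℓ^skew[α,β]f uniformly on ℝ and Er^so[nα,nβ]f converges to Er^skew[α,β]f uniformly on ℝ as n → ∞ through the positive integers; that is, for every ε > 0 there exists N such that for every natural number n ≥ N and every x ∈ ℝ one has |Eℓ^so[nα,nβ]f(x) − Eℓ^skew[α,β]f(x)| ≤ ε and |Er^so[nα,nβ]f(x) − Er^skew[α,β]f(x)| ≤ ε. -/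
open MeasureTheory Filter

/-- Left snapping-out extension `Eℓ^so[α,β]f`. -/
noncomputable def Elso (α β : ℝ) (f : ℝ → ℝ) (x : ℝ) : ℝ :=
  if x ≤ 0 then f x
  else f (-x) + 2 * α * ∫ y in (0 : ℝ)..x, Real.exp (-(α + β) * (x - y)) * (f y - f (-y))

/-- Right snapping-out extension `Er^so[α,β]f`. -/
noncomputable def Erso (α β : ℝ) (f : ℝ → ℝ) (x : ℝ) : ℝ :=
  if 0 ≤ x then f x
  else f (-x) - 2 * β * ∫ y in (0 : ℝ)..(-x), Real.exp (-(α + β) * (-x - y)) * (f y - f (-y))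

/-- Left skew extension `Eℓ^skew[α,β]f`. -/
noncomputable def Elskew (α β : ℝ) (f : ℝ → ℝ) (x : ℝ) : ℝ :=
  if x ≤ 0 then f x
  else ((β - α) / (α + β)) * f (-x) + (2 * α / (α + β)) * f x

/-- Right skew extension `Er^skew[α,β]f`. -/
noncomputable def Erskew (α β : ℝ) (f : ℝ → ℝ) (x : ℝ) : ℝ :=
  if 0 ≤ x then f x
  else (2 * β / (α + β)) * f x + ((α - β) / (α + β)) * f (-x)

theorem so_key (g : ℝ → ℝ) (hg : Continuous g) (g0 : g 0 = 0) (e K l : ℝ) (hl : 0 < l)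
    (h : ∀ x y : ℝ, 0 ≤ y → y ≤ x → |g y - g x| ≤ e + K * (x - y)) (x : ℝ) (hx : 0 ≤ x) :
    |l * (∫ y in (0 : ℝ)..x, Real.exp (-l * (x - y)) * g y) - g x| ≤ e + K / l := by
  have hE : ∀ y : ℝ, HasDerivAt (fun y => Real.exp (-l * (x - y)))
      (l * Real.exp (-l * (x - y))) y := by
    intro y
    have h1 : HasDerivAt (fun y : ℝ => -l * (x - y)) (-l * (0 - 1)) y :=
      ((hasDerivAt_const y x).sub (hasDerivAt_id y)).const_mul (-l)
    convert h1.exp using 1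
    ring
  have i1 : ∫ y in (0 : ℝ)..x, l * Real.exp (-l * (x - y)) = 1 - Real.exp (-l * x) := by
    rw [intervalIntegral.integral_eq_sub_of_hasDerivAt (fun y _ => hE y)
      (Continuous.intervalIntegrable (by fun_prop) _ _)]
    simp
  have i2 : ∫ y in (0 : ℝ)..x, l * Real.exp (-l * (x - y)) * (e + K * (x - y))
      = (e + K / l) - Real.exp (-l * x) * (e + K * x + K / l) := by
    rw [intervalIntegral.integral_eq_sub_of_hasDerivAt
      (f := fun y => Real.exp (-l * (x - y)) * (e + K * (x - y) + K / l)) (fun y _ => ?_)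
      (Continuous.intervalIntegrable (by fun_prop) _ _)]
    · simp
    · have h1 : HasDerivAt (fun y : ℝ => e + K * (x - y) + K / l) (K * (0 - 1)) y :=
        ((((hasDerivAt_const y x).sub (hasDerivAt_id y)).const_mul K).const_add e).add_const _
      have h2 : l * (K / l) = K := mul_div_cancel₀ K hl.ne'
      refine ((hE y).mul h1).congr_deriv ?_
      linear_combination Real.exp (-l * (x - y)) * h2
  have i3 : l * (∫ y in (0 : ℝ)..x, Real.exp (-l * (x - y)) * g y) - g x
      = (∫ y in (0 : ℝ)..x, l * Real.exp (-l * (x - y)) * (g y - g x))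
        - Real.exp (-l * x) * g x := by
    have : ∫ y in (0 : ℝ)..x, l * Real.exp (-l * (x - y)) * (g y - g x)
        = (∫ y in (0 : ℝ)..x, l * (Real.exp (-l * (x - y)) * g y))
          - ∫ y in (0 : ℝ)..x, l * Real.exp (-l * (x - y)) * g x := by
      rw [← intervalIntegral.integral_sub
        (Continuous.intervalIntegrable (by fun_prop) _ _)
        (Continuous.intervalIntegrable (by fun_prop) _ _)]
      congr 1
      ext y
      ring
    rw [this, intervalIntegral.integral_mul_const, i1, intervalIntegral.integral_const_mul]
    ring
  have i4 : |∫ y in (0 : ℝ)..x, l * Real.exp (-l * (x - y)) * (g y - g x)|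
      ≤ ∫ y in (0 : ℝ)..x, l * Real.exp (-l * (x - y)) * (e + K * (x - y)) := by
    refine (intervalIntegral.abs_integral_le_integral_abs hx).trans ?_
    refine intervalIntegral.integral_mono_on hx
      (Continuous.intervalIntegrable (by fun_prop) _ _)
      (Continuous.intervalIntegrable (by fun_prop) _ _) (fun y hy => ?_)
    have hp : 0 < l * Real.exp (-l * (x - y)) := by positivity
    rw [abs_mul, abs_of_pos hp]
    exact mul_le_mul_of_nonneg_left (h x y hy.1 hy.2) hp.le
  have i5 : |Real.exp (-l * x) * g x| ≤ Real.exp (-l * x) * (e + K * x) := by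
    rw [abs_mul, abs_of_pos (Real.exp_pos _)]
    refine mul_le_mul_of_nonneg_left ?_ (Real.exp_pos _).le
    have := h x 0 le_rfl hx
    simpa [g0] using this
  have i6 : 0 ≤ Real.exp (-l * x) * (K / l) := by
    have h1 : 0 ≤ K := by
      by_contra hK
      push Not at hK
      have h2 := h (|e| / (-K) + 1) 0 le_rfl (by have : 0 < -K := by linarith
                                                 positivity)
      have h3 := (abs_nonneg _).trans h2
      have h4 : K * (|e| / (-K) + 1 - 0) = -|e| + K := by
        have h5 : K ≠ 0 := hK.ne
        field_simp
        ring
      have := le_abs_self e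
      rw [h4] at h3
      linarith
    positivity
  rw [i3]
  refine (abs_sub _ _).trans ?_
  rw [i2] at i4
  nlinarith

theorem so_modulus (f : ℝ → ℝ) (hcont : Continuous f)
    (hbdd : ∃ M : ℝ, ∀ x : ℝ, |f x| ≤ M)
    (hlim_top : ∃ Lp : ℝ, Tendsto f atTop (nhds Lp))
    (hlim_bot : ∃ Lm : ℝ, Tendsto f atBot (nhds Lm)) (e : ℝ) (he : 0 < e) :
    ∃ K : ℝ, ∀ x y : ℝ, 0 ≤ y → y ≤ x →
      |(f y - f (-y)) - (f x - f (-x))| ≤ e + K * (x - y) := by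
  obtain ⟨M, hM⟩ := hbdd
  obtain ⟨Lp, hp⟩ := hlim_top
  obtain ⟨Lm, hm⟩ := hlim_bot
  have hM0 : 0 ≤ M := (abs_nonneg _).trans (hM 0)
  have ht : Tendsto (fun x : ℝ => f ‖x‖ - f (-‖x‖)) (cocompact ℝ) (nhds (Lp - Lm)) :=
    (hp.comp (tendsto_norm_cocompact_atTop (E := ℝ))).sub
      (hm.comp (tendsto_neg_atTop_atBot.comp (tendsto_norm_cocompact_atTop (E := ℝ))))
  have hu : UniformContinuous (fun x : ℝ => f ‖x‖ - f (-‖x‖)) :=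
    Continuous.uniformContinuous_of_tendsto_cocompact (by fun_prop) ht
  obtain ⟨d, hd, H⟩ := Metric.uniformContinuous_iff.1 hu e he
  refine ⟨4 * M / d, fun x y hy hyx => ?_⟩
  have hxy : 0 ≤ x - y := by linarith
  by_cases hc : x - y < d
  · have h1 := H (a := y) (b := x) (by rw [dist_comm, Real.dist_eq, abs_of_nonneg hxy]; exact hc)
    rw [Real.dist_eq] at h1
    simp only [Real.norm_eq_abs, abs_of_nonneg hy, abs_of_nonneg (hy.trans hyx)] at h1
    have : 0 ≤ 4 * M / d * (x - y) := by positivity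
    linarith
  · push Not at hc
    have h2 : 4 * M ≤ 4 * M / d * (x - y) := by
      rw [div_mul_eq_mul_div, le_div_iff₀ hd]
      gcongr
    have a1 := abs_le.1 (hM x)
    have a2 := abs_le.1 (hM y)
    have a3 := abs_le.1 (hM (-x))
    have a4 := abs_le.1 (hM (-y))
    rw [abs_le]
    constructor <;> linarith

theorem snappingOut_extensions_tendsto_skew_extensions
    (α β : ℝ) (hα : 0 ≤ α) (hβ : 0 ≤ β) (hαβ : 0 < α + β) (f : ℝ → ℝ)
    (hcont : Continuous f)
    (hbdd : ∃ M : ℝ, ∀ x : ℝ, |f x| ≤ M)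
    (hlim_top : ∃ Lp : ℝ, Tendsto f atTop (nhds Lp))
    (hlim_bot : ∃ Lm : ℝ, Tendsto f atBot (nhds Lm)) :
    ∀ ε > 0, ∃ N : ℕ, ∀ n : ℕ, N ≤ n → ∀ x : ℝ,
      |Elso ((n : ℝ) * α) ((n : ℝ) * β) f x - Elskew α β f x| ≤ ε ∧
      |Erso ((n : ℝ) * α) ((n : ℝ) * β) f x - Erskew α β f x| ≤ ε := by
  intro ε hε
  obtain ⟨K, hK⟩ := so_modulus f hcont hbdd hlim_top hlim_bot (ε / 4) (by positivity)
  obtain ⟨N, hN⟩ := exists_nat_gt (4 * K / (ε * (α + β)))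
  refine ⟨N + 1, fun n hn x => ?_⟩
  have hn1 : (N : ℝ) + 1 ≤ n := by exact_mod_cast hn
  have hN0 : (0 : ℝ) ≤ N := Nat.cast_nonneg N
  have hn0 : (0 : ℝ) < n := by linarith
  have hl : 0 < (n : ℝ) * (α + β) := by positivity
  have key : ∀ z : ℝ, 0 ≤ z →
      |(n : ℝ) * (α + β) * (∫ y in (0 : ℝ)..z,
        Real.exp (-((n : ℝ) * α + (n : ℝ) * β) * (z - y)) * (f y - f (-y))) - (f z - f (-z))|
        ≤ ε / 2 := by
    intro z hz
    have h1 := so_key (fun y => f y - f (-y)) (by fun_prop) (by simp) (ε / 4) K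
      ((n : ℝ) * (α + β)) hl hK z hz
    have h2 : K / ((n : ℝ) * (α + β)) ≤ ε / 4 := by
      rw [div_le_iff₀ hl]
      rw [div_lt_iff₀ (by positivity)] at hN
      have : (N : ℝ) * (ε * (α + β)) ≤ n * (ε * (α + β)) := by
        gcongr
        linarith
      linarith
    rw [mul_add] at h1 h2 ⊢
    exact h1.trans (by linarith)
  have fin : ∀ a A : ℝ, 0 ≤ a → a ≤ α + β → |A| ≤ ε / 2 → |2 * a / (α + β) * A| ≤ ε := by
    intro a A h0 h1 h2
    have h3 : 2 * a / (α + β) ≤ 2 := by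
      rw [div_le_iff₀ hαβ]
      linarith
    rw [abs_mul, abs_of_nonneg (by positivity : 0 ≤ 2 * a / (α + β))]
    calc _ ≤ 2 * (ε / 2) := mul_le_mul h3 h2 (abs_nonneg _) (by norm_num)
      _ = ε := by ring
  constructor
  · unfold Elso Elskew
    split_ifs with hx
    · simpa using hε.le
    · have h1 := fin α _ hα (by linarith) (key x (by linarith))
      convert h1 using 2
      field_simp
      ring
  · unfold Erso Erskew
    split_ifs with hx
    · simpa using hε.le
    · have h1 := fin β _ hβ (by linarith) (key (-x) (by linarith))
      rw [← abs_neg]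
      convert h1 using 2
      rw [neg_neg]
      field_simp
      ring
end

section
/- Let α, β ≥ 0 with α + β > 0, let M ≥ 0, and let f : ℝ → ℝ be measurable with |f(x)| ≤ M for all x ∈ ℝ. Then |Eℓ^so[α,β]f(x)| ≤ (1 + 4α/(α+β))·M and |Er^so[α,β]f(x)| ≤ (1 + 4β/(α+β))·M for every x ∈ ℝ; consequently, |C^so[α,β](t)f(x)| ≤ 5·M for every t ∈ ℝ and every x ≠ 0. -/
open MeasureTheory Filter

/-- Snapping-out cosine family `C^so[α,β](t)f(x)` (for `x ≠ 0`). -/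
noncomputable def Cso (α β : ℝ) (f : ℝ → ℝ) (t x : ℝ) : ℝ :=
  if x < 0 then (1 / 2) * (Elso α β f (x + t) + Elso α β f (x - t))
  else (1 / 2) * (Erso α β f (x + t) + Erso α β f (x - t))

theorem so_aux (c : ℝ) (hc : 0 < c) (M : ℝ) (hM : 0 ≤ M) (f : ℝ → ℝ)
    (hbdd : ∀ x : ℝ, |f x| ≤ M) (x : ℝ) (hx : 0 ≤ x) :
    |∫ y in (0 : ℝ)..x, Real.exp (-c * (x - y)) * (f y - f (-y))| ≤ 2 * M / c := by
  have hd : ∀ y ∈ Set.uIcc 0 x, HasDerivAt (fun y => 2 * M / c * Real.exp (-c * (x - y)))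
      (Real.exp (-c * (x - y)) * (2 * M)) y := by
    intro y _
    have h1 : HasDerivAt (fun y : ℝ => -c * (x - y)) (-c * (-1)) y :=
      ((hasDerivAt_id y).const_sub x).const_mul (-c)
    have h2 := (h1.exp).const_mul (2 * M / c)
    refine h2.congr_deriv ?_
    have hc' := hc.ne'
    field_simp
  have hi : IntervalIntegrable (fun y => Real.exp (-c * (x - y)) * (2 * M)) volume 0 x :=
    Continuous.intervalIntegrable (by fun_prop) _ _
  have h := intervalIntegral.norm_integral_le_of_norm_le (μ := volume)
    (f := fun y => Real.exp (-c * (x - y)) * (f y - f (-y))) hx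
    (Filter.Eventually.of_forall (fun y _ => by
      rw [norm_mul, Real.norm_eq_abs, Real.norm_eq_abs, Real.abs_exp]
      have h1 := abs_sub (f y) (f (-y))
      have h2 := hbdd y
      have h3 := hbdd (-y)
      exact mul_le_mul_of_nonneg_left (by linarith) (Real.exp_pos _).le)) hi
  rw [intervalIntegral.integral_eq_sub_of_hasDerivAt hd hi, Real.norm_eq_abs] at h
  refine h.trans ?_
  have h0 : 0 ≤ 2 * M / c * Real.exp (-c * (x - 0)) := by positivity
  simp only [sub_self, mul_zero, Real.exp_zero, mul_one]
  linarith

theorem so_aux2 (a c : ℝ) (ha : 0 ≤ a) (hc : 0 < c) (M I u : ℝ)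
    (hu : |u| ≤ M) (hI : |I| ≤ 2 * M / c) :
    |u + 2 * a * I| ≤ (1 + 4 * a / c) * M ∧ |u - 2 * a * I| ≤ (1 + 4 * a / c) * M := by
  have h1 : |2 * a * I| ≤ 2 * a * (2 * M / c) := by
    rw [abs_mul, abs_of_nonneg (by positivity : 0 ≤ 2 * a)]
    exact mul_le_mul_of_nonneg_left hI (by positivity)
  have h2 : (1 + 4 * a / c) * M = M + 2 * a * (2 * M / c) := by ring
  rw [h2]
  rw [abs_le] at h1 hu
  constructor <;> rw [abs_le] <;> constructor <;> linarith [h1.1, h1.2, hu.1, hu.2]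

theorem snappingOut_extensions_bounded
    (α β : ℝ) (hα : 0 ≤ α) (hβ : 0 ≤ β) (hαβ : 0 < α + β)
    (M : ℝ) (hM : 0 ≤ M) (f : ℝ → ℝ)
    (hmeas : Measurable f)
    (hbdd : ∀ x : ℝ, |f x| ≤ M) :
    (∀ x : ℝ, |Elso α β f x| ≤ (1 + 4 * α / (α + β)) * M) ∧
    (∀ x : ℝ, |Erso α β f x| ≤ (1 + 4 * β / (α + β)) * M) ∧
    (∀ t x : ℝ, x ≠ 0 → |Cso α β f t x| ≤ 5 * M) := by
  have hle : ∀ a, 0 ≤ a → M ≤ (1 + 4 * a / (α + β)) * M := fun a ha => by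
    have : 0 ≤ 4 * a / (α + β) * M := by positivity
    linarith
  have h5 : ∀ a, a ≤ α + β → (1 + 4 * a / (α + β)) * M ≤ 5 * M := fun a ha => by
    have : 4 * a / (α + β) ≤ 4 := by
      rw [div_le_iff₀ hαβ]; linarith
    exact mul_le_mul_of_nonneg_right (by linarith) hM
  have hl : ∀ x : ℝ, |Elso α β f x| ≤ (1 + 4 * α / (α + β)) * M := by
    intro x
    unfold Elso
    split_ifs with h
    · exact (hbdd x).trans (hle α hα)
    · exact (so_aux2 α (α + β) hα hαβ M _ _ (hbdd _)
        (so_aux (α + β) hαβ M hM f hbdd x (by linarith))).1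
  have hr : ∀ x : ℝ, |Erso α β f x| ≤ (1 + 4 * β / (α + β)) * M := by
    intro x
    unfold Erso
    split_ifs with h
    · exact (hbdd x).trans (hle β hβ)
    · exact (so_aux2 β (α + β) hβ hαβ M _ _ (hbdd _)
        (so_aux (α + β) hαβ M hM f hbdd (-x) (by linarith))).2
  refine ⟨hl, hr, ?_⟩
  intro t x _
  unfold Cso
  split_ifs with h
  · have h1 := abs_le.1 ((hl (x + t)).trans (h5 α (by linarith)))
    have h2 := abs_le.1 ((hl (x - t)).trans (h5 α (by linarith)))
    rw [abs_le]
    constructor <;> linarith [h1.1, h1.2, h2.1, h2.2]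
  · have h1 := abs_le.1 ((hr (x + t)).trans (h5 β (by linarith)))
    have h2 := abs_le.1 ((hr (x - t)).trans (h5 β (by linarith)))
    rw [abs_le]
    constructor <;> linarith [h1.1, h1.2, h2.1, h2.2]
end

section
/- Let α, β ≥ 0 with α + β > 0 and let f : ℝ → ℝ be continuous, bounded, and possess finite limits at +∞ and at −∞. Then for every ε > 0 there exists N such that for every natural number n ≥ N, every t ∈ ℝ, and every x ≠ 0, one has |C^so[nα,nβ](t)f(x) − C^skew[α,β](t)f(x)| ≤ ε. -/
open MeasureTheory Filter


/-- Skew cosine family `C^skew[α,β](t)f(x)` (for `x ≠ 0`). -/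
noncomputable def Cskew (α β : ℝ) (f : ℝ → ℝ) (t x : ℝ) : ℝ :=
  if x < 0 then (1 / 2) * (Elskew α β f (x + t) + Elskew α β f (x - t))
  else (1 / 2) * (Erskew α β f (x + t) + Erskew α β f (x - t))

lemma core_bound (g : ℝ → ℝ) (hg : Continuous g) (g0 : g 0 = 0) (e C l : ℝ) (he : 0 < e)
    (hC : 0 ≤ C) (hl : 0 < l)
    (hb : ∀ x y : ℝ, 0 ≤ x → 0 ≤ y → |g y - g x| ≤ e + C * |y - x|) (x : ℝ) (hx : 0 < x) :
    |l * (∫ y in (0 : ℝ)..x, Real.exp (-l * (x - y)) * g y) - g x| ≤ 2 * e + 2 * (C / l) := by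
  have hE : ∀ y, HasDerivAt (fun y => Real.exp (-l * (x - y))) (Real.exp (-l * (x - y)) * l) y := by
    intro y
    have h1 : HasDerivAt (fun y => -l * (x - y)) l y := by
      have := ((hasDerivAt_id y).const_sub x).const_mul (-l)
      simpa using this
    exact h1.exp
  have i1 : ∫ y in (0 : ℝ)..x, Real.exp (-l * (x - y)) * l = 1 - Real.exp (-l * x) := by
    rw [intervalIntegral.integral_eq_sub_of_hasDerivAt (fun y _ => hE y)
      (Continuous.intervalIntegrable (by fun_prop) _ _)]
    simp
  have hF : ∀ y, HasDerivAt (fun y => Real.exp (-l * (x - y)) * (e + C * (x - y) + C / l))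
      (l * (Real.exp (-l * (x - y)) * (e + C * (x - y)))) y := by
    intro y
    have h2 : HasDerivAt (fun y => e + C * (x - y) + C / l) (-C) y := by
      have := ((((hasDerivAt_id y).const_sub x).const_mul C).const_add e).add_const (C / l)
      simpa using this
    have := (hE y).mul h2
    refine HasDerivAt.congr_deriv this ?_
    have hc : l * (C / l) = C := by field_simp
    linear_combination (Real.exp (-l * (x - y))) * hc
  have i2 : ∫ y in (0 : ℝ)..x, l * (Real.exp (-l * (x - y)) * (e + C * (x - y)))
      ≤ e + C / l := by
    rw [intervalIntegral.integral_eq_sub_of_hasDerivAt (fun y _ => hF y)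
      (Continuous.intervalIntegrable (by fun_prop) _ _)]
    have : 0 ≤ Real.exp (-l * (x - 0)) * (e + C * (x - 0) + C / l) := by
      rw [sub_zero]; positivity
    simp only [sub_self, mul_zero, Real.exp_zero] at this ⊢
    linarith
  have i3 : |∫ y in (0 : ℝ)..x, l * (Real.exp (-l * (x - y)) * (g y - g x))| ≤ e + C / l := by
    refine le_trans ?_ i2
    rw [← Real.norm_eq_abs]
    apply intervalIntegral.norm_integral_le_of_norm_le hx.le
    · refine Eventually.of_forall fun y hy => ?_
      rw [Real.norm_eq_abs, abs_mul, abs_mul, abs_of_pos hl, Real.abs_exp]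
      have := hb x y hx.le hy.1.le
      rw [abs_sub_comm y x, abs_of_nonneg (sub_nonneg.2 hy.2)] at this
      gcongr
    · exact Continuous.intervalIntegrable (by fun_prop) _ _
  have i4 : ∫ y in (0 : ℝ)..x, l * (Real.exp (-l * (x - y)) * (g y - g x))
      = l * (∫ y in (0 : ℝ)..x, Real.exp (-l * (x - y)) * g y) - (1 - Real.exp (-l * x)) * g x := by
    rw [← i1, ← intervalIntegral.integral_const_mul, ← intervalIntegral.integral_mul_const,
      ← intervalIntegral.integral_sub]
    · congr 1; ext y; ring
    · exact Continuous.intervalIntegrable (by fun_prop) _ _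
    · exact Continuous.intervalIntegrable (by fun_prop) _ _
  have i5 : |Real.exp (-l * x) * g x| ≤ e + C / l := by
    have h := hb 0 x le_rfl hx.le
    rw [g0, sub_zero, sub_zero, abs_of_pos hx] at h
    rw [abs_mul, Real.abs_exp]
    have h1 : Real.exp (-l * x) ≤ 1 := Real.exp_le_one_iff.2 (by nlinarith)
    have h2 : Real.exp (-l * x) * (l * x) ≤ 1 := by
      have h3 : l * x ≤ Real.exp (l * x) := by linarith [Real.add_one_le_exp (l * x)]
      calc Real.exp (-l * x) * (l * x) ≤ Real.exp (-l * x) * Real.exp (l * x) := by gcongr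
        _ = 1 := by rw [← Real.exp_add]; simp
    have h4 : Real.exp (-l * x) * (C * x) ≤ C / l := by
      rw [le_div_iff₀ hl]
      nlinarith
    calc Real.exp (-l * x) * |g x| ≤ Real.exp (-l * x) * (e + C * x) := by gcongr
      _ ≤ e + C / l := by nlinarith
  rw [i4] at i3
  have := abs_le.1 i3
  have := abs_le.1 i5
  rw [abs_le]
  constructor <;> nlinarith

lemma core_unif (g : ℝ → ℝ) (hg : Continuous g) (g0 : g 0 = 0) (L B : ℝ)
    (hB : ∀ x, |g x| ≤ B) (hL : Tendsto g atTop (nhds L)) (e : ℝ) (he : 0 < e) :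
    ∃ K : ℝ, 0 < K ∧ ∀ l, K ≤ l → ∀ x, 0 < x →
      |l * (∫ y in (0 : ℝ)..x, Real.exp (-l * (x - y)) * g y) - g x| ≤ e := by
  have hu : UniformContinuous (fun y => g |y|) := by
    apply Continuous.uniformContinuous_of_tendsto_cocompact (x := L) (by fun_prop)
    exact hL.comp (tendsto_norm_cocompact_atTop (E := ℝ))
  obtain ⟨d, hd, h⟩ := Metric.uniformContinuous_iff.1 hu (e / 4) (by positivity)
  have hB0 : 0 ≤ B := (abs_nonneg _).trans (hB 0)
  refine ⟨8 * B / d / e + 1, by positivity, fun l hl x hx => ?_⟩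
  have hl0 : 0 < l := lt_of_lt_of_le (by positivity) hl
  have := core_bound g hg g0 (e / 4) (2 * B / d) l (by positivity) (by positivity) hl0 ?_ x hx
  · refine this.trans ?_
    have : 2 * B / d / l ≤ e / 4 := by
      rw [div_le_iff₀ hl0]
      have h1 : 8 * B / d / e * e = 8 * B / d := by field_simp
      have h2 : 8 * B / d = 4 * (2 * B / d) := by ring
      nlinarith
    linarith
  · intro x y hx hy
    by_cases hxy : |y - x| < d
    · have := h (a := y) (b := x) (by rwa [Real.dist_eq])
      rw [Real.dist_eq, abs_of_nonneg hx, abs_of_nonneg hy] at this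
      have : 0 ≤ 2 * B / d * |y - x| := by positivity
      linarith
    · push Not at hxy
      have h1 : 2 * B ≤ 2 * B / d * |y - x| := by
        calc 2 * B = 2 * B / d * d := by field_simp
          _ ≤ _ := by gcongr
      have h2 := abs_sub (g y) (g x)
      linarith [hB x, hB y]

theorem snappingOut_cosine_tendsto_skew_cosine_uniform
    (α β : ℝ) (hα : 0 ≤ α) (hβ : 0 ≤ β) (hαβ : 0 < α + β) (f : ℝ → ℝ)
    (hcont : Continuous f)
    (hbdd : ∃ M : ℝ, ∀ x : ℝ, |f x| ≤ M)
    (hlim_top : ∃ Lp : ℝ, Tendsto f atTop (nhds Lp))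
    (hlim_bot : ∃ Lm : ℝ, Tendsto f atBot (nhds Lm)) :
    ∀ ε > 0, ∃ N : ℕ, ∀ n : ℕ, N ≤ n → ∀ t x : ℝ, x ≠ 0 →
      |Cso ((n : ℝ) * α) ((n : ℝ) * β) f t x - Cskew α β f t x| ≤ ε := by
  intro ε hε
  obtain ⟨M, hM⟩ := hbdd
  obtain ⟨Lp, hLp⟩ := hlim_top
  obtain ⟨Lm, hLm⟩ := hlim_bot
  obtain ⟨K, hK, H⟩ := core_unif (fun y => f y - f (-y)) (by fun_prop) (by simp) (Lp - Lm) (M + M)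
    (fun x => (abs_sub _ _).trans (add_le_add (hM _) (hM _)))
    (hLp.sub (hLm.comp tendsto_neg_atTop_atBot)) (ε / 2) (by positivity)
  obtain ⟨N, hN⟩ := exists_nat_ge (K / (α + β))
  refine ⟨N, fun n hn t x _ => ?_⟩
  have hl : K ≤ n * α + n * β := by
    have : K / (α + β) ≤ n := hN.trans (by exact_mod_cast hn)
    rw [div_le_iff₀ hαβ] at this
    linarith
  have H := H _ hl
  have key : ∀ c D : ℝ, 0 ≤ c → c ≤ α + β → |D| ≤ ε / 2 → |2 * c / (α + β) * D| ≤ ε := by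
    intro c D h0 h1 hD
    have h2 : 2 * c / (α + β) ≤ 2 := by rw [div_le_iff₀ hαβ]; linarith
    rw [abs_mul, abs_of_nonneg (by positivity)]
    calc _ ≤ 2 * (ε / 2) := by gcongr
      _ = ε := by ring
  have hl' : ∀ z, |Elso (n * α) (n * β) f z - Elskew α β f z| ≤ ε := by
    intro z
    unfold Elso Elskew
    split_ifs with hz
    · simpa using hε.le
    · push Not at hz
      refine le_of_eq_of_le ?_ (key α _ hα (by linarith) (H z hz))
      congr 1
      field_simp
      ring
  have hr' : ∀ z, |Erso (n * α) (n * β) f z - Erskew α β f z| ≤ ε := by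
    intro z
    unfold Erso Erskew
    split_ifs with hz
    · simpa using hε.le
    · push Not at hz
      refine le_of_eq_of_le ?_ (key β _ hβ (by linarith) (H (-z) (by linarith)))
      rw [← abs_neg]
      congr 1
      simp only [neg_neg]
      field_simp
      ring
  unfold Cso Cskew
  split_ifs
  · have h1 := abs_le.1 (hl' (x + t))
    have h2 := abs_le.1 (hl' (x - t))
    rw [abs_le]; constructor <;> linarith
  · have h1 := abs_le.1 (hr' (x + t))
    have h2 := abs_le.1 (hr' (x - t))
    rw [abs_le]; constructor <;> linarith
end

section
/- Let α, β ≥ 0 with α + β > 0 and let f : ℝ → ℝ be continuous and bounded with f(x) → L₊ as x → +∞ and f(x) → L₋ as x → −∞. Then for every x ≠ 0, the Cesàro means (1/t)·∫_0^t C^skew[α,β](s)f(x) ds converge, as t → +∞, to (β·L₋ + α·L₊)/(α+β). -/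
open MeasureTheory Filter

theorem cesaro_aux (g : ℝ → ℝ) (L K : ℝ) (hg : Continuous g) (hK : ∀ s, |g s| ≤ K)
    (hL : Tendsto g atTop (nhds L)) :
    Tendsto (fun t : ℝ => (1 / t) * ∫ s in (0 : ℝ)..t, g s) atTop (nhds L) := by
  have h1 : Tendsto (fun t : ℝ => ∫ u in (0 : ℝ)..1, g (t * u)) atTop
      (nhds (∫ u in (0 : ℝ)..1, L)) := by
    apply intervalIntegral.tendsto_integral_filter_of_dominated_convergence (fun _ => K)
    · exact Eventually.of_forall fun t =>
        (hg.comp (continuous_const.mul continuous_id)).aestronglyMeasurable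
    · exact Eventually.of_forall fun t => Eventually.of_forall fun u _ => hK _
    · exact intervalIntegrable_const
    · refine Eventually.of_forall fun u hu => ?_
      rw [Set.uIoc_of_le zero_le_one] at hu
      exact hL.comp (tendsto_id.atTop_mul_const hu.1)
  simp only [intervalIntegral.integral_const, sub_zero, one_smul] at h1
  refine h1.congr' ?_
  filter_upwards [eventually_gt_atTop 0] with t ht
  rw [intervalIntegral.integral_comp_mul_left g ht.ne']
  simp

theorem Elskew_cont (α β : ℝ) (hαβ : 0 < α + β) (f : ℝ → ℝ) (hf : Continuous f) :
    Continuous (Elskew α β f) := by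
  unfold Elskew
  refine Continuous.if_le hf (by fun_prop) continuous_id continuous_const ?_
  rintro x rfl
  simp only [neg_zero, id]
  field_simp
  ring

theorem Erskew_cont (α β : ℝ) (hαβ : 0 < α + β) (f : ℝ → ℝ) (hf : Continuous f) :
    Continuous (Erskew α β f) := by
  unfold Erskew
  refine Continuous.if_le hf (by fun_prop) continuous_const continuous_id ?_
  rintro x rfl
  simp only [neg_zero]
  field_simp
  ring

theorem comb_bdd (a b u v M : ℝ) (hu : |u| ≤ M) (hv : |v| ≤ M) :
    |a * u + b * v| ≤ (1 + |a| + |b|) * M := by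
  have h0 : 0 ≤ M := (abs_nonneg u).trans hu
  have := abs_add_le (a * u) (b * v)
  rw [abs_mul, abs_mul] at this
  nlinarith [mul_le_mul_of_nonneg_left hu (abs_nonneg a),
    mul_le_mul_of_nonneg_left hv (abs_nonneg b)]

theorem Elskew_bdd (α β : ℝ) (f : ℝ → ℝ) (M : ℝ) (h : ∀ x, |f x| ≤ M) :
    ∃ K, ∀ x, |Elskew α β f x| ≤ K := by
  refine ⟨(1 + |(β - α) / (α + β)| + |2 * α / (α + β)|) * M, fun x => ?_⟩
  unfold Elskew
  split_ifs
  · have h0 : 0 ≤ M := (abs_nonneg _).trans (h x)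
    refine (h x).trans (le_mul_of_one_le_left h0 ?_)
    linarith [abs_nonneg ((β - α) / (α + β)), abs_nonneg (2 * α / (α + β))]
  · exact comb_bdd _ _ _ _ _ (h _) (h _)

theorem Erskew_bdd (α β : ℝ) (f : ℝ → ℝ) (M : ℝ) (h : ∀ x, |f x| ≤ M) :
    ∃ K, ∀ x, |Erskew α β f x| ≤ K := by
  refine ⟨(1 + |2 * β / (α + β)| + |(α - β) / (α + β)|) * M, fun x => ?_⟩
  unfold Erskew
  split_ifs
  · have h0 : 0 ≤ M := (abs_nonneg _).trans (h x)
    refine (h x).trans (le_mul_of_one_le_left h0 ?_)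
    linarith [abs_nonneg ((α - β) / (α + β)), abs_nonneg (2 * β / (α + β))]
  · exact comb_bdd _ _ _ _ _ (h _) (h _)

theorem half_aux (E : ℝ → ℝ) (A B x : ℝ) (hE : Continuous E) (hb : ∃ K, ∀ x, |E x| ≤ K)
    (hA : Tendsto E atTop (nhds A)) (hB : Tendsto E atBot (nhds B)) :
    Tendsto (fun t : ℝ => (1 / t) * ∫ s in (0 : ℝ)..t, (1 / 2) * (E (x + s) + E (x - s)))
      atTop (nhds ((1 / 2) * (A + B))) := by
  obtain ⟨K, hK⟩ := hb
  apply cesaro_aux _ _ K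
  · fun_prop
  · intro s
    have h1 := abs_le.1 (hK (x + s))
    have h2 := abs_le.1 (hK (x - s))
    rw [abs_le]
    constructor <;> linarith [h1.1, h1.2, h2.1, h2.2]
  · refine Tendsto.const_mul _ (Tendsto.add (hA.comp ?_) (hB.comp ?_))
    · exact tendsto_atTop_add_const_left _ _ tendsto_id
    · have h := tendsto_atBot_add_const_left atTop x (tendsto_neg_atTop_atBot (G := ℝ))
      exact h.congr fun s => (sub_eq_add_neg x s).symm

theorem skew_cosine_cesaro_mean
    (α β : ℝ) (hα : 0 ≤ α) (hβ : 0 ≤ β) (hαβ : 0 < α + β)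
    (f : ℝ → ℝ) (Lp Lm : ℝ)
    (hcont : Continuous f)
    (hbdd : ∃ M : ℝ, ∀ x : ℝ, |f x| ≤ M)
    (hlim_top : Tendsto f atTop (nhds Lp))
    (hlim_bot : Tendsto f atBot (nhds Lm)) :
    ∀ x : ℝ, x ≠ 0 →
      Tendsto (fun t : ℝ => (1 / t) * ∫ s in (0 : ℝ)..t, Cskew α β f s x)
        atTop (nhds ((β * Lm + α * Lp) / (α + β))) := by
  obtain ⟨M, hM⟩ := hbdd
  intro x hx
  unfold Cskew
  have hp : Tendsto (fun y => f (-y)) atTop (nhds Lm) := hlim_bot.comp tendsto_neg_atTop_atBot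
  have hm : Tendsto (fun y => f (-y)) atBot (nhds Lp) := hlim_top.comp tendsto_neg_atBot_atTop
  by_cases h : x < 0
  · simp only [if_pos h]
    have := half_aux (Elskew α β f) ((β - α) / (α + β) * Lm + 2 * α / (α + β) * Lp) Lm x
      (Elskew_cont α β hαβ f hcont) (Elskew_bdd α β f M hM) ?_ ?_
    · convert this using 2
      field_simp
      ring
    · refine ((hp.const_mul _).add (hlim_top.const_mul _)).congr' ?_
      filter_upwards [eventually_gt_atTop 0] with y hy
      simp [Elskew, not_le.2 hy]
    · refine hlim_bot.congr' ?_
      filter_upwards [eventually_le_atBot 0] with y hy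
      simp [Elskew, hy]
  · simp only [if_neg h]
    have := half_aux (Erskew α β f) Lp (2 * β / (α + β) * Lm + (α - β) / (α + β) * Lp) x
      (Erskew_cont α β hαβ f hcont) (Erskew_bdd α β f M hM) ?_ ?_
    · convert this using 2
      field_simp
      ring
    · refine hlim_top.congr' ?_
      filter_upwards [eventually_ge_atTop 0] with y hy
      simp [Erskew, hy]
    · refine ((hlim_bot.const_mul _).add (hm.const_mul _)).congr' ?_
      filter_upwards [eventually_lt_atBot 0] with y hy
      simp [Erskew, not_le.2 hy]
end

section
/- Let α, β ≥ 0 with α + β > 0 and let f : ℝ → ℝ be bounded, continuous on ℝ∖{0}, with finite one-sided limits at 0, and with f(x) → L₊ as x → +∞ and f(x) → L₋ as x → −∞. Then for every x ≠ 0, the Cesàro means (1/t)·∫_0^t C^so[α,β](s)f(x) ds converge, as t → +∞, to (β·L₋ + α·L₊)/(α+β). -/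
open MeasureTheory Filter

lemma so_conv (c : ℝ) (hc : 0 < c) (h : ℝ → ℝ) (hm : Measurable h) (B : ℝ)
    (hB : ∀ x, |h x| ≤ B) :
    Measurable (fun x : ℝ => ∫ y in (0 : ℝ)..x, Real.exp (-c * (x - y)) * h y) ∧
    (∃ K, ∀ x : ℝ, 0 ≤ x → |∫ y in (0 : ℝ)..x, Real.exp (-c * (x - y)) * h y| ≤ K) ∧
    (∀ H, Tendsto h atTop (nhds H) →
      Tendsto (fun x : ℝ => ∫ y in (0 : ℝ)..x, Real.exp (-c * (x - y)) * h y) atTop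
        (nhds (H / c))) := by
  have hB0 : 0 ≤ B := (abs_nonneg _).trans (hB 0)
  have key : ∀ x : ℝ, 0 ≤ x → (∫ y in (0 : ℝ)..x, Real.exp (-c * (x - y)) * h y) =
      ∫ u in Set.Ioi (0 : ℝ), (Set.Iic x).indicator (fun u => Real.exp (-c * u) * h (x - u)) u := by
    intro x hx
    have h1 := intervalIntegral.integral_comp_sub_left (a := 0) (b := x)
      (fun y => Real.exp (-c * (x - y)) * h y) x
    simp only [sub_self, sub_zero, sub_sub_cancel] at h1
    rw [← h1, intervalIntegral.integral_of_le hx, setIntegral_indicator measurableSet_Iic,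
      Set.Ioi_inter_Iic]
  have hint : Integrable (fun u : ℝ => Real.exp (-c * u) * B) (volume.restrict (Set.Ioi 0)) :=
    (integrableOn_exp_mul_Ioi (by linarith : -c < 0) 0).mul_const B
  have hbd : ∀ x u : ℝ, ‖(Set.Iic x).indicator (fun u => Real.exp (-c * u) * h (x - u)) u‖
      ≤ Real.exp (-c * u) * B := by
    intro x u
    refine (norm_indicator_le_norm_self _ _).trans ?_
    rw [norm_mul, Real.norm_eq_abs, Real.abs_exp, Real.norm_eq_abs]
    exact mul_le_mul_of_nonneg_left (hB _) (Real.exp_pos _).le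
  refine ⟨?_, ⟨∫ u in Set.Ioi (0 : ℝ), Real.exp (-c * u) * B, ?_⟩, ?_⟩
  · have e : (fun x : ℝ => ∫ y in (0 : ℝ)..x, Real.exp (-c * (x - y)) * h y) =
        fun x => Real.exp (-c * x) * ∫ y in (0 : ℝ)..x, Real.exp (c * y) * h y := by
      funext x
      rw [← intervalIntegral.integral_const_mul]
      congr 1
      funext y
      rw [← mul_assoc, ← Real.exp_add]
      congr 2
      ring
    rw [e]
    refine Continuous.measurable (Continuous.mul (by fun_prop) ?_)
    refine intervalIntegral.continuous_primitive (fun a b => ?_) 0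
    have hh : IntervalIntegrable h volume a b := by
      refine (intervalIntegrable_const (c := B)).mono_fun hm.aestronglyMeasurable ?_
      refine Eventually.of_forall fun x => ?_
      simpa [abs_of_nonneg hB0] using hB x
    exact hh.continuousOn_mul (by fun_prop)
  · intro x hx
    rw [key x hx, ← Real.norm_eq_abs]
    exact norm_integral_le_of_norm_le hint (Eventually.of_forall (hbd x))
  · intro H hH
    have hval : H / c = ∫ u in Set.Ioi (0 : ℝ), Real.exp (-c * u) * H := by
      rw [integral_mul_const, integral_exp_mul_Ioi (by linarith : -c < 0) 0]
      simp
      field_simp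
    rw [hval]
    have := tendsto_integral_filter_of_dominated_convergence (l := (atTop : Filter ℝ))
      (μ := volume.restrict (Set.Ioi (0 : ℝ)))
      (F := fun x => (Set.Iic x).indicator (fun u => Real.exp (-c * u) * h (x - u)))
      (f := fun u => Real.exp (-c * u) * H) (fun u : ℝ => Real.exp (-c * u) * B)
      (Eventually.of_forall fun x => by
        refine (Measurable.indicator ?_ measurableSet_Iic).aestronglyMeasurable
        fun_prop)
      (Eventually.of_forall fun x => Eventually.of_forall (hbd x)) hint
      (Eventually.of_forall fun u => by
        have : Tendsto (fun x => Real.exp (-c * u) * h (x - u)) atTop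
            (nhds (Real.exp (-c * u) * H)) :=
          (hH.comp (tendsto_atTop_add_const_right _ (-u) tendsto_id)).const_mul _
        refine this.congr' ?_
        filter_upwards [eventually_ge_atTop u] with x hx
        rw [Set.indicator_of_mem (show u ∈ Set.Iic x from hx)])
    refine this.congr' ?_
    filter_upwards [eventually_ge_atTop 0] with x hx
    exact (key x hx).symm

lemma so_cesaro (g : ℝ → ℝ) (hm : Measurable g) (K : ℝ) (hK : ∀ s, |g s| ≤ K) (L : ℝ)
    (hL : Tendsto g atTop (nhds L)) :
    Tendsto (fun t : ℝ => (1 / t) * ∫ s in (0 : ℝ)..t, g s) atTop (nhds L) := by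
  have := intervalIntegral.tendsto_integral_filter_of_dominated_convergence
    (l := (atTop : Filter ℝ)) (a := 0) (b := 1) (μ := volume)
    (F := fun t s => g (t * s)) (f := fun _ => L) (fun _ => K)
    (Eventually.of_forall fun t => by
      exact (hm.comp (measurable_const_mul t)).aestronglyMeasurable)
    (Eventually.of_forall fun t => Eventually.of_forall fun s _ => hK _)
    intervalIntegrable_const
    (Eventually.of_forall fun s hs => by
      rw [Set.uIoc_of_le zero_le_one] at hs
      exact hL.comp (tendsto_id.atTop_mul_const hs.1))
  simp only [intervalIntegral.integral_const, sub_zero, one_smul] at this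
  refine this.congr' ?_
  filter_upwards [eventually_gt_atTop 0] with t ht
  rw [intervalIntegral.integral_comp_mul_left _ ht.ne']
  simp

lemma so_Elso (α β : ℝ) (hαβ : 0 < α + β) (f : ℝ → ℝ) (Lp Lm M : ℝ)
    (hM : ∀ x : ℝ, |f x| ≤ M) (hm : Measurable f)
    (hp : Tendsto f atTop (nhds Lp)) (hn : Tendsto f atBot (nhds Lm)) :
    Measurable (Elso α β f) ∧ (∃ K, ∀ x, |Elso α β f x| ≤ K) ∧
    Tendsto (Elso α β f) atBot (nhds Lm) ∧
    Tendsto (Elso α β f) atTop (nhds (Lm + 2 * α * ((Lp - Lm) / (α + β)))) := by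
  obtain ⟨m1, ⟨K, hK⟩, l1⟩ := so_conv (α + β) hαβ (fun y => f y - f (-y)) (by fun_prop) (M + M)
    (fun x => (abs_sub _ _).trans (add_le_add (hM _) (hM _)))
  have hn' : Tendsto (fun x => f (-x)) atTop (nhds Lm) := hn.comp tendsto_neg_atTop_atBot
  refine ⟨?_, ⟨M + |2 * α| * |K|, fun x => ?_⟩, ?_, ?_⟩
  · unfold Elso
    exact Measurable.ite measurableSet_Iic hm ((hm.comp measurable_neg).add (m1.const_mul _))
  · unfold Elso
    split_ifs with hx
    · have := hM x
      have : 0 ≤ |2 * α| * |K| := by positivity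
      linarith
    · refine (abs_add_le _ _).trans (add_le_add (hM _) ?_)
      rw [abs_mul]
      exact mul_le_mul_of_nonneg_left ((hK x (by linarith)).trans (le_abs_self _)) (abs_nonneg _)
  · refine hn.congr' ?_
    filter_upwards [eventually_le_atBot 0] with x hx
    simp [Elso, hx]
  · refine (hn'.add ((l1 _ (hp.sub hn')).const_mul (2 * α))).congr' ?_
    filter_upwards [eventually_gt_atTop 0] with x hx
    simp [Elso, not_le.mpr hx]

lemma so_Erso (α β : ℝ) (f : ℝ → ℝ) (x : ℝ) :
    Erso α β f x = Elso β α (fun y => f (-y)) (-x) := by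
  unfold Erso Elso
  by_cases hx : 0 ≤ x
  · simp [hx]
  · rw [if_neg hx, if_neg (by linarith), sub_eq_add_neg, ← mul_neg,
      ← intervalIntegral.integral_neg]
    simp only [neg_neg]
    congr 2
    congr 1
    funext y
    rw [add_comm β α]
    ring

lemma so_mean (E : ℝ → ℝ) (hm : Measurable E) (K : ℝ) (hK : ∀ x, |E x| ≤ K) (A B x L : ℝ)
    (hA : Tendsto E atBot (nhds A)) (hB : Tendsto E atTop (nhds B)) (hL : 1 / 2 * (B + A) = L) :
    Tendsto (fun t : ℝ => (1 / t) * ∫ s in (0 : ℝ)..t, (1 / 2) * (E (x + s) + E (x - s)))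
      atTop (nhds L) := by
  refine so_cesaro (fun s => (1 / 2) * (E (x + s) + E (x - s))) (by fun_prop) K (fun s => ?_) L ?_
  · have h1 := abs_le.mp (hK (x + s))
    have h2 := abs_le.mp (hK (x - s))
    rw [abs_le]
    constructor <;> linarith
  · rw [← hL]
    refine Tendsto.const_mul _ (Tendsto.add (hB.comp ?_) (hA.comp ?_))
    · exact tendsto_atTop_add_const_left _ x tendsto_id
    · exact (tendsto_atBot_add_const_left _ x tendsto_neg_atTop_atBot).congr
        fun s => (sub_eq_add_neg x s).symm

theorem snappingOut_cosine_cesaro_mean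
    (α β : ℝ) (hα : 0 ≤ α) (hβ : 0 ≤ β) (hαβ : 0 < α + β)
    (f : ℝ → ℝ) (Lp Lm : ℝ)
    (hbdd : ∃ M : ℝ, ∀ x : ℝ, |f x| ≤ M)
    (hcont : ContinuousOn f {(0 : ℝ)}ᶜ)
    (hlim_right : ∃ cp : ℝ, Tendsto f (nhdsWithin 0 (Set.Ioi 0)) (nhds cp))
    (hlim_left : ∃ cm : ℝ, Tendsto f (nhdsWithin 0 (Set.Iio 0)) (nhds cm))
    (hlim_top : Tendsto f atTop (nhds Lp))
    (hlim_bot : Tendsto f atBot (nhds Lm)) :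
    ∀ x : ℝ, x ≠ 0 →
      Tendsto (fun t : ℝ => (1 / t) * ∫ s in (0 : ℝ)..t, Cso α β f s x)
        atTop (nhds ((β * Lm + α * Lp) / (α + β))) := by
  intro x hx
  obtain ⟨M, hM⟩ := hbdd
  have hm : Measurable f := measurable_of_continuousOn_compl_singleton 0 hcont
  rcases lt_or_gt_of_ne hx with h | h
  · obtain ⟨m, ⟨K, hK⟩, l1, l2⟩ := so_Elso α β hαβ f Lp Lm M hM hm hlim_top hlim_bot
    simp only [Cso, if_pos h]
    refine so_mean _ m K hK _ _ x _ l1 l2 ?_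
    field_simp
    ring
  · obtain ⟨m, ⟨K, hK⟩, l1, l2⟩ := so_Elso β α (by linarith) (fun y => f (-y)) Lm Lp M
      (fun y => hM _) (hm.comp measurable_neg) (hlim_bot.comp tendsto_neg_atTop_atBot)
      (hlim_top.comp tendsto_neg_atBot_atTop)
    simp only [Cso, if_neg (not_lt.mpr h.le)]
    have e : Erso α β f = fun x => Elso β α (fun y => f (-y)) (-x) := funext (so_Erso α β f)
    refine so_mean (Erso α β f) ?_ K ?_ (Lp + 2 * β * ((Lm - Lp) / (β + α)))
      Lp x _ ?_ ?_ ?_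
    · rw [e]; exact m.comp measurable_neg
    · intro y; rw [e]; exact hK _
    · rw [e]; exact l2.comp tendsto_neg_atBot_atTop
    · rw [e]; exact l1.comp tendsto_neg_atTop_atBot
    · rw [add_comm β α]
      field_simp
      ring
end

section
/- Let α, β ≥ 0 with α + β > 0 and let f₁, f₂ : ℝ → ℝ be continuous, bounded, with finite limits at +∞ and −∞. For each positive integer n define g₁ₙ(x) := f₁^e(x) + (1/2)(γ+2α)·n·∫_{(−∞,x]} ((1/γ)·k₁(y) − (1/2)·k₂(y))·e^{−nγ(x−y)} dy − (1/2)(γ−2α)·n·∫_{[x,∞)} ((1/γ)·k₁(y) + (1/2)·k₂(y))·e^{nγ(x−y)} dy and g₂ₙ(x) := f₂^e(x) + (1/2)(γ+2β)·n·∫_{[x,∞)} ((1/γ)·k₁(y) + (1/2)·k₂(y))·e^{nγ(x−y)} dy − (1/2)(γ−2β)·n·∫_{(−∞,x]} ((1/γ)·k₁(y) − (1/2)·k₂(y))·e^{−nγ(x−y)} dy. Then, as n → ∞, g₁ₙ converges uniformly on ℝ to f₁^e + (2α/γ²)·k₁ − (1/2)·k₂ and g₂ₙ converges uniformly on ℝ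 to f₂^e + (2β/γ²)·k₁ + (1/2)·k₂. -/
open MeasureTheory Filter

/-- Even part of a function: `f^e = (f + fᵀ)/2`. -/
noncomputable def feven (f : ℝ → ℝ) (x : ℝ) : ℝ := (f x + f (-x)) / 2

/-- Odd part of a function: `f^o = (f − fᵀ)/2`. -/
noncomputable def fodd (f : ℝ → ℝ) (x : ℝ) : ℝ := (f x - f (-x)) / 2

/-- `γ = √(2(α² + β²))`. -/
noncomputable def gammaAB (α β : ℝ) : ℝ := Real.sqrt (2 * (α ^ 2 + β ^ 2))

/-- `k₁ = α·f₁^o + β·f₂^o`. -/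
noncomputable def kOne (α β : ℝ) (f₁ f₂ : ℝ → ℝ) (y : ℝ) : ℝ :=
  α * fodd f₁ y + β * fodd f₂ y

/-- `k₂ = f₁^e − f₂^e`. -/
noncomputable def kTwo (f₁ f₂ : ℝ → ℝ) (y : ℝ) : ℝ := feven f₁ y - feven f₂ y

theorem aux_shift (F : ℝ → ℝ) (x : ℝ) :
    ∫ y in Set.Ioi x, F y = ∫ t in Set.Ioi (0:ℝ), F (x + t) := by
  have h := (measurePreserving_add_left (volume : Measure ℝ) x).setIntegral_preimage_emb
    (measurableEmbedding_addLeft x) F (Set.Ioi x)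
  rw [← h]
  congr 2
  ext t
  simp

theorem aux_shift_neg (F : ℝ → ℝ) (x : ℝ) :
    ∫ y in Set.Iic x, F y = ∫ t in Set.Ioi (0:ℝ), F (x - t) := by
  have h := integral_comp_neg_Iic x (fun y => F (-y))
  simp only [neg_neg] at h
  rw [h, aux_shift]
  congr 1
  ext t
  congr 1
  ring

theorem aux_core (k : ℝ → ℝ) (hk : Continuous k) (m ε C : ℝ) (hm : 0 < m) (hC : 0 ≤ C)
    (hb : ∀ t > 0, |k t - k 0| ≤ ε + C * t) :
    |(∫ t in Set.Ioi (0:ℝ), k t * Real.exp (-m * t)) - k 0 / m| ≤ ε / m + 4 * C / m ^ 2 := by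
  have i1 : IntegrableOn (fun t : ℝ => Real.exp (-m * t)) (Set.Ioi 0) :=
    exp_neg_integrableOn_Ioi 0 hm
  have i2 : IntegrableOn (fun t : ℝ => Real.exp (-(m/2) * t)) (Set.Ioi 0) :=
    exp_neg_integrableOn_Ioi 0 (half_pos hm)
  have e1 : ∫ t in Set.Ioi (0:ℝ), Real.exp (-m * t) = 1 / m := by
    rw [integral_exp_mul_Ioi (by linarith)]
    simp
  have e2 : ∫ t in Set.Ioi (0:ℝ), Real.exp (-(m/2) * t) = 2 / m := by
    rw [integral_exp_mul_Ioi (by linarith)]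
    simp
  have i3 : IntegrableOn (fun t : ℝ => ε * Real.exp (-m * t)
      + (2 * C / m) * Real.exp (-(m/2) * t)) (Set.Ioi 0) :=
    (i1.const_mul _).add (i2.const_mul _)
  have bd : ∀ t ∈ Set.Ioi (0:ℝ), ‖(k t - k 0) * Real.exp (-m * t)‖ ≤
      ε * Real.exp (-m * t) + (2 * C / m) * Real.exp (-(m/2) * t) := by
    intro t ht
    rw [norm_mul, Real.norm_eq_abs, Real.norm_eq_abs, Real.abs_exp]
    have h1 := hb t ht
    have h2 : m / 2 * t ≤ Real.exp (m / 2 * t) := by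
      linarith [Real.add_one_le_exp (m / 2 * t)]
    have h3 : Real.exp (-(m/2) * t) = Real.exp (m / 2 * t) * Real.exp (-m * t) := by
      rw [← Real.exp_add]; congr 1; ring
    have h4 : t ≤ 2 / m * Real.exp (m / 2 * t) := by
      calc t = 2 / m * (m / 2 * t) := by field_simp
        _ ≤ _ := by gcongr
    have hp := Real.exp_pos (-m * t)
    rw [h3]
    calc |k t - k 0| * Real.exp (-m * t) ≤ (ε + C * t) * Real.exp (-m * t) := by gcongr
      _ ≤ (ε + C * (2 / m * Real.exp (m / 2 * t))) * Real.exp (-m * t) := by gcongr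
      _ = _ := by ring
  have i4 : IntegrableOn (fun t : ℝ => (k t - k 0) * Real.exp (-m * t)) (Set.Ioi 0) := by
    refine Integrable.mono' i3 ?_ ?_
    · exact Continuous.aestronglyMeasurable (by fun_prop)
    · exact (ae_restrict_iff' measurableSet_Ioi).2 (Eventually.of_forall bd)
  have e3 : ∫ t in Set.Ioi (0:ℝ), k t * Real.exp (-m * t)
      = (∫ t in Set.Ioi (0:ℝ), (k t - k 0) * Real.exp (-m * t)) + k 0 / m := by
    have : (fun t : ℝ => k t * Real.exp (-m * t)) =
        fun t => (k t - k 0) * Real.exp (-m * t) + k 0 * Real.exp (-m * t) := by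
      ext t; ring
    rw [this, integral_add i4 (i1.const_mul _), integral_const_mul, e1]
    ring
  rw [e3, add_sub_cancel_right]
  have := norm_integral_le_of_norm_le i3 ((ae_restrict_iff' measurableSet_Ioi).2
    (Eventually.of_forall bd))
  rw [integral_add (i1.const_mul _) (i2.const_mul _), integral_const_mul, integral_const_mul,
    e1, e2, Real.norm_eq_abs] at this
  refine this.trans (le_of_eq ?_)
  field_simp
  ring

theorem aux_modulus (h : ℝ → ℝ) (hu : UniformContinuous h) (M : ℝ) (hM : ∀ x, |h x| ≤ M)
    (ε : ℝ) (hε : 0 < ε) : ∃ C : ℝ, 0 ≤ C ∧ ∀ x y, |h y - h x| ≤ ε + C * |y - x| := by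
  obtain ⟨δ, hδ, H⟩ := Metric.uniformContinuous_iff.1 hu ε hε
  have hM0 : 0 ≤ M := (abs_nonneg _).trans (hM 0)
  refine ⟨2 * M / δ, by positivity, fun x y => ?_⟩
  by_cases hxy : |y - x| < δ
  · have := H (a := y) (b := x) (by rwa [Real.dist_eq])
    rw [Real.dist_eq] at this
    have : 0 ≤ 2 * M / δ * |y - x| := by positivity
    linarith
  · push Not at hxy
    have h1 : |h y - h x| ≤ 2 * M := by
      have := abs_sub (h y) (h x)
      linarith [hM x, hM y]
    have h2 : 2 * M ≤ 2 * M / δ * |y - x| := by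
      calc 2 * M = 2 * M / δ * δ := by field_simp
        _ ≤ _ := by gcongr
    linarith

theorem aux_conv (h : ℝ → ℝ) (hu : UniformContinuous h) (M : ℝ) (hM : ∀ x, |h x| ≤ M)
    (c : ℝ) (hc : 0 < c) (ε : ℝ) (hε : 0 < ε) : ∃ N : ℕ, ∀ n : ℕ, N ≤ n → ∀ x : ℝ,
      |(n:ℝ) * (∫ y in Set.Iic x, h y * Real.exp (-(n:ℝ) * c * (x - y))) - h x / c| ≤ ε ∧
      |(n:ℝ) * (∫ y in Set.Ici x, h y * Real.exp ((n:ℝ) * c * (x - y))) - h x / c| ≤ ε := by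
  obtain ⟨C, hC, H⟩ := aux_modulus h hu M hM (ε * c / 2) (by positivity)
  obtain ⟨N, hN⟩ := exists_nat_gt (8 * C / (c ^ 2 * ε))
  refine ⟨N + 1, fun n hn x => ?_⟩
  have hn' : (N:ℝ) + 1 ≤ n := by exact_mod_cast hn
  have hN0 : (0:ℝ) ≤ N := Nat.cast_nonneg N
  have hn0 : (0:ℝ) < n := by linarith
  have key : ∀ k : ℝ → ℝ, Continuous k → (∀ t > 0, |k t - k 0| ≤ ε * c / 2 + C * t) →
      |(n:ℝ) * (∫ t in Set.Ioi (0:ℝ), k t * Real.exp (-(n * c) * t)) - k 0 / c| ≤ ε := by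
    intro k hk hb
    have := aux_core k hk (n * c) (ε * c / 2) C (by positivity) hC hb
    have e : (n:ℝ) * (∫ t in Set.Ioi (0:ℝ), k t * Real.exp (-(n * c) * t)) - k 0 / c
        = n * ((∫ t in Set.Ioi (0:ℝ), k t * Real.exp (-(n * c) * t)) - k 0 / (n * c)) := by
      field_simp
    rw [e, abs_mul, abs_of_pos hn0]
    have h8 : 4 * C / (c ^ 2 * n) ≤ ε / 2 := by
      have : 8 * C / (c ^ 2 * ε) ≤ n := by linarith
      rw [div_le_iff₀ (by positivity)] at this
      rw [div_le_iff₀ (by positivity)]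
      linarith
    calc _ ≤ (n:ℝ) * (ε * c / 2 / (n * c) + 4 * C / (n * c) ^ 2) := by gcongr
      _ = ε / 2 + 4 * C / (c ^ 2 * n) := by field_simp
      _ ≤ ε := by linarith
  have hcont := hu.continuous
  constructor
  · rw [aux_shift_neg]
    have := key (fun t => h (x - t)) (by fun_prop) (fun t ht => by
      have := H x (x - t)
      have e : |x - t - x| = t := by
        rw [show x - t - x = -t by ring, abs_neg, abs_of_pos ht]
      rw [e] at this
      simpa using this)
    simp only [sub_zero] at this
    convert this using 7
    congr 1
    ring
  · rw [integral_Ici_eq_integral_Ioi, aux_shift]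
    have := key (fun t => h (x + t)) (by fun_prop) (fun t ht => by
      have := H x (x + t)
      have e : |x + t - x| = t := by
        rw [show x + t - x = t by ring, abs_of_pos ht]
      rw [e] at this
      simpa using this)
    simp only [add_zero] at this
    convert this using 7
    congr 1
    ring

theorem aux_uc_s10 (f : ℝ → ℝ) (hf : Continuous f) (ht : ∃ L : ℝ, Tendsto f atTop (nhds L))
    (hb : ∃ L : ℝ, Tendsto f atBot (nhds L)) : UniformContinuous f := by
  obtain ⟨A, hA⟩ := ht
  obtain ⟨B, hB⟩ := hb
  have hcl : UniformContinuous (fun x : ℝ => max 0 (min x 1)) :=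
    ((LipschitzWith.id.min_const (1:ℝ)).const_max 0).uniformContinuous
  have hφ : UniformContinuous (fun x : ℝ => (A - B) * max 0 (min x 1) + B) :=
    (hcl.const_mul' (A - B)).add uniformContinuous_const
  have hg : UniformContinuous (fun x : ℝ => f x - ((A - B) * max 0 (min x 1) + B)) := by
    refine Continuous.uniformContinuous_of_tendsto_cocompact (x := 0)
      (hf.sub hφ.continuous) ?_
    rw [cocompact_eq_atBot_atTop, tendsto_sup]
    constructor
    · have : Tendsto (fun x => f x - B) atBot (nhds 0) := by
        simpa using hB.sub_const B
      refine this.congr' ?_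
      filter_upwards [eventually_le_atBot (0:ℝ)] with x hx
      rw [min_eq_left (by linarith), max_eq_left hx]; ring
    · have : Tendsto (fun x => f x - A) atTop (nhds 0) := by
        simpa using hA.sub_const A
      refine this.congr' ?_
      filter_upwards [eventually_ge_atTop (1:ℝ)] with x hx
      rw [min_eq_right hx, max_eq_right (by norm_num)]; ring
  simpa using hg.add hφ

theorem aux_bound (a b u v η : ℝ) (ha : 0 ≤ a) (hb : |b| ≤ a) (hu : |u| ≤ η) (hv : |v| ≤ η) :
    |(1 / 2) * a * u - (1 / 2) * b * v| ≤ a * η := by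
  have h1 : |a * u| ≤ a * η := by rw [abs_mul, abs_of_nonneg ha]; gcongr
  have h2 : |b * v| ≤ a * η := by rw [abs_mul]; gcongr
  rw [abs_le] at *
  constructor <;> linarith

theorem snappingOut_projections_tendsto_skew_projection
    (α β : ℝ) (hα : 0 ≤ α) (hβ : 0 ≤ β) (hαβ : 0 < α + β)
    (f₁ f₂ : ℝ → ℝ)
    (hcont₁ : Continuous f₁) (hcont₂ : Continuous f₂)
    (hbdd₁ : ∃ M : ℝ, ∀ x : ℝ, |f₁ x| ≤ M)
    (hbdd₂ : ∃ M : ℝ, ∀ x : ℝ, |f₂ x| ≤ M)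
    (hlim₁_top : ∃ L : ℝ, Tendsto f₁ atTop (nhds L))
    (hlim₁_bot : ∃ L : ℝ, Tendsto f₁ atBot (nhds L))
    (hlim₂_top : ∃ L : ℝ, Tendsto f₂ atTop (nhds L))
    (hlim₂_bot : ∃ L : ℝ, Tendsto f₂ atBot (nhds L)) :
    ∀ ε > 0, ∃ N : ℕ, ∀ n : ℕ, N ≤ n → ∀ x : ℝ,
      |(feven f₁ x
          + (1 / 2) * (gammaAB α β + 2 * α) * (n : ℝ) *
            (∫ y in Set.Iic x,
              ((1 / gammaAB α β) * kOne α β f₁ f₂ y - (1 / 2) * kTwo f₁ f₂ y) *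
                Real.exp (-(n : ℝ) * gammaAB α β * (x - y)))
          - (1 / 2) * (gammaAB α β - 2 * α) * (n : ℝ) *
            (∫ y in Set.Ici x,
              ((1 / gammaAB α β) * kOne α β f₁ f₂ y + (1 / 2) * kTwo f₁ f₂ y) *
                Real.exp ((n : ℝ) * gammaAB α β * (x - y))))
        - (feven f₁ x + (2 * α / (gammaAB α β) ^ 2) * kOne α β f₁ f₂ x
            - (1 / 2) * kTwo f₁ f₂ x)| ≤ ε ∧
      |(feven f₂ x
          + (1 / 2) * (gammaAB α β + 2 * β) * (n : ℝ) *
            (∫ y in Set.Ici x,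
              ((1 / gammaAB α β) * kOne α β f₁ f₂ y + (1 / 2) * kTwo f₁ f₂ y) *
                Real.exp ((n : ℝ) * gammaAB α β * (x - y)))
          - (1 / 2) * (gammaAB α β - 2 * β) * (n : ℝ) *
            (∫ y in Set.Iic x,
              ((1 / gammaAB α β) * kOne α β f₁ f₂ y - (1 / 2) * kTwo f₁ f₂ y) *
                Real.exp (-(n : ℝ) * gammaAB α β * (x - y))))
        - (feven f₂ x + (2 * β / (gammaAB α β) ^ 2) * kOne α β f₁ f₂ x
            + (1 / 2) * kTwo f₁ f₂ x)| ≤ ε := by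
  intro ε hε
  have hg : 0 < gammaAB α β := by
    apply Real.sqrt_pos.2
    have : 0 < (α + β) ^ 2 := by positivity
    nlinarith [sq_nonneg (α - β)]
  set g := gammaAB α β with hgdef
  have u₁ := aux_uc_s10 f₁ hcont₁ hlim₁_top hlim₁_bot
  have u₂ := aux_uc_s10 f₂ hcont₂ hlim₂_top hlim₂_bot
  obtain ⟨M₁, hM₁⟩ := hbdd₁
  obtain ⟨M₂, hM₂⟩ := hbdd₂
  have un₁ : UniformContinuous (fun x => f₁ (-x)) := u₁.comp uniformContinuous_neg
  have un₂ : UniformContinuous (fun x => f₂ (-x)) := u₂.comp uniformContinuous_neg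
  have uc : ∀ a b c d : ℝ, UniformContinuous
      (fun x => a * f₁ x + b * f₁ (-x) + c * f₂ x + d * f₂ (-x)) := fun a b c d =>
    (((u₁.const_mul' a).add (un₁.const_mul' b)).add (u₂.const_mul' c)).add (un₂.const_mul' d)
  have bd : ∀ a b c d : ℝ, ∀ x, |a * f₁ x + b * f₁ (-x) + c * f₂ x + d * f₂ (-x)| ≤
      |a| * M₁ + |b| * M₁ + |c| * M₂ + |d| * M₂ := by
    intro a b c d x
    refine (abs_add_le _ _).trans (add_le_add ((abs_add_le _ _).trans
      (add_le_add ((abs_add_le _ _).trans (add_le_add ?_ ?_)) ?_)) ?_) <;>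
    · rw [abs_mul]
      exact mul_le_mul_of_nonneg_left (by first | exact hM₁ _ | exact hM₂ _) (abs_nonneg _)
  have hp : (fun y => (1 / g) * kOne α β f₁ f₂ y - (1 / 2) * kTwo f₁ f₂ y) =
      fun x => (α / (2 * g) - 1 / 4) * f₁ x + (-α / (2 * g) - 1 / 4) * f₁ (-x)
        + (β / (2 * g) + 1 / 4) * f₂ x + (-β / (2 * g) + 1 / 4) * f₂ (-x) := by
    ext y
    simp only [kOne, kTwo, feven, fodd]
    field_simp
    ring
  have hq : (fun y => (1 / g) * kOne α β f₁ f₂ y + (1 / 2) * kTwo f₁ f₂ y) =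
      fun x => (α / (2 * g) + 1 / 4) * f₁ x + (-α / (2 * g) + 1 / 4) * f₁ (-x)
        + (β / (2 * g) - 1 / 4) * f₂ x + (-β / (2 * g) - 1 / 4) * f₂ (-x) := by
    ext y
    simp only [kOne, kTwo, feven, fodd]
    field_simp
    ring
  have hη : 0 < ε / (g + 2 * α + 2 * β) := by positivity
  obtain ⟨N₁, h₁⟩ := aux_conv (fun y => (1 / g) * kOne α β f₁ f₂ y - (1 / 2) * kTwo f₁ f₂ y)
    (by rw [hp]; exact uc _ _ _ _) _ (fun x => by rw [congrFun hp x]; exact bd _ _ _ _ x)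
    g hg _ hη
  obtain ⟨N₂, h₂⟩ := aux_conv (fun y => (1 / g) * kOne α β f₁ f₂ y + (1 / 2) * kTwo f₁ f₂ y)
    (by rw [hq]; exact uc _ _ _ _) _ (fun x => by rw [congrFun hq x]; exact bd _ _ _ _ x)
    g hg _ hη
  refine ⟨max N₁ N₂, fun n hn x => ?_⟩
  have hA := (h₁ n (le_trans (le_max_left _ _) hn) x).1
  have hB := (h₂ n (le_trans (le_max_right _ _) hn) x).2
  clear h₁ h₂
  beta_reduce at hA hB
  generalize (∫ y in Set.Iic x, ((1 / g) * kOne α β f₁ f₂ y - (1 / 2) * kTwo f₁ f₂ y) *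
    Real.exp (-(n : ℝ) * g * (x - y))) = A at hA ⊢
  generalize (∫ y in Set.Ici x, ((1 / g) * kOne α β f₁ f₂ y + (1 / 2) * kTwo f₁ f₂ y) *
    Real.exp ((n : ℝ) * g * (x - y))) = B at hB ⊢
  constructor
  · have := aux_bound (g + 2 * α) (g - 2 * α) _ _ _ (by positivity)
      (by rw [abs_le]; constructor <;> linarith) hA hB
    refine le_trans (le_of_eq ?_) (this.trans ?_)
    · congr 1
      field_simp
      ring
    · rw [mul_div_assoc', div_le_iff₀ (by positivity), mul_comm]
      exact mul_le_mul_of_nonneg_left (by linarith) hε.le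
  · have := aux_bound (g + 2 * β) (g - 2 * β) _ _ _ (by positivity)
      (by rw [abs_le]; constructor <;> linarith) hB hA
    refine le_trans (le_of_eq ?_) (this.trans ?_)
    · congr 1
      field_simp
      ring
    · rw [mul_div_assoc', div_le_iff₀ (by positivity), mul_comm]
      exact mul_le_mul_of_nonneg_left (by linarith) hε.le
end

section
/- Let α, β ≥ 0 with α + β > 0. Then for all functions f₁, f₂ : ℝ → ℝ: (i) P^skew[α,β](f₁,f₂) belongs to 𝒞^skew[α,β]; (ii) P^skew[α,β](f₁,f₂) = (f₁,f₂) if and only if (f₁,f₂) belongs to 𝒞^skew[α,β]. In particular, P^skew[α,β] is idempotent (applying it twice gives the same result as applying it once) and its range is exactly 𝒞^skew[α,β]. -/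
open MeasureTheory Filter

/-- The skew projection `P^skew[α,β]`. -/
noncomputable def Pskew (α β : ℝ) (p : (ℝ → ℝ) × (ℝ → ℝ)) : (ℝ → ℝ) × (ℝ → ℝ) :=
  (fun x => feven p.1 x + (2 * α / (gammaAB α β) ^ 2) * kOne α β p.1 p.2 x
      - (1 / 2) * kTwo p.1 p.2 x,
   fun x => feven p.2 x + (2 * β / (gammaAB α β) ^ 2) * kOne α β p.1 p.2 x
      + (1 / 2) * kTwo p.1 p.2 x)

/-- The space `𝒞^skew[α,β]`. -/
def CskewSet (α β : ℝ) : Set ((ℝ → ℝ) × (ℝ → ℝ)) :=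
  {p | ∀ x : ℝ, feven p.1 x = feven p.2 x ∧ β * fodd p.1 x = α * fodd p.2 x}

theorem Pskew_is_projection_onto_CskewSet
    (α β : ℝ) (hα : 0 ≤ α) (hβ : 0 ≤ β) (hαβ : 0 < α + β) :
    (∀ f₁ f₂ : ℝ → ℝ, Pskew α β (f₁, f₂) ∈ CskewSet α β) ∧
    (∀ f₁ f₂ : ℝ → ℝ, Pskew α β (f₁, f₂) = (f₁, f₂) ↔ (f₁, f₂) ∈ CskewSet α β) ∧
    (∀ p : (ℝ → ℝ) × (ℝ → ℝ), Pskew α β (Pskew α β p) = Pskew α β p) ∧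
    Set.range (Pskew α β) = CskewSet α β := by
  have hs : 0 < α ^ 2 + β ^ 2 := by
    rcases hα.eq_or_lt with h | h
    · have : 0 < β := by linarith
      positivity
    · positivity
  have hg : gammaAB α β ^ 2 = 2 * (α ^ 2 + β ^ 2) := by
    unfold gammaAB
    exact Real.sq_sqrt (by positivity)
  have h1 : ∀ f₁ f₂ : ℝ → ℝ, Pskew α β (f₁, f₂) ∈ CskewSet α β := by
    intro f₁ f₂ x
    simp only [Pskew, feven, fodd, kOne, kTwo, neg_neg]
    constructor <;> ring
  have h2 : ∀ f₁ f₂ : ℝ → ℝ, (f₁, f₂) ∈ CskewSet α β → Pskew α β (f₁, f₂) = (f₁, f₂) := by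
    intro f₁ f₂ h
    apply Prod.ext <;> funext x <;> obtain ⟨he, ho⟩ := h x <;>
      simp only [Pskew, kOne, kTwo, hg]
    · have e : 2 * α / (2 * (α ^ 2 + β ^ 2)) * (α * fodd f₁ x + β * fodd f₂ x) = fodd f₁ x := by
        field_simp
        simp only at ho
        linear_combination (-β) * ho
      rw [e]
      simp only [feven, fodd] at *
      linarith
    · have e : 2 * β / (2 * (α ^ 2 + β ^ 2)) * (α * fodd f₁ x + β * fodd f₂ x) = fodd f₂ x := by
        field_simp
        simp only at ho
        linear_combination α * ho
      rw [e]
      simp only [feven, fodd] at *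
      linarith
  refine ⟨h1, fun f₁ f₂ => ⟨fun h => h ▸ h1 f₁ f₂, h2 f₁ f₂⟩, fun p => h2 _ _ (h1 p.1 p.2), ?_⟩
  ext p
  constructor
  · rintro ⟨q, rfl⟩
    exact h1 q.1 q.2
  · intro h
    exact ⟨p, h2 p.1 p.2 h⟩
end

section
/- Let α, β ≥ 0 with α + β > 0, let y > 0, let f₁, f₂ : ℝ → ℝ be continuous, and set (p₁,p₂) := P^skew[α,β](f₁,f₂). Then for every pair (g₁,g₂) ∈ 𝒞^skew[α,β] with g₁ and g₂ continuous, ∫_{−y}^{y} ((g₁(x)−f₁(x))² + (g₂(x)−f₂(x))²) dx ≥ ∫_{−y}^{y} ((p₁(x)−f₁(x))² + (p₂(x)−f₂(x))²) dx. -/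
open MeasureTheory Filter

theorem aux_sym (y : ℝ) (hy : 0 < y) (F G : ℝ → ℝ) (hF : Continuous F) (hG : Continuous G)
    (h : ∀ x, F x + F (-x) ≤ G x + G (-x)) :
    ∫ x in (-y)..y, F x ≤ ∫ x in (-y)..y, G x := by
  have e : ∀ H : ℝ → ℝ, Continuous H →
      ∫ x in (-y)..y, (H x + H (-x)) = 2 * ∫ x in (-y)..y, H x := by
    intro H hH
    have hH' : Continuous fun x => H (-x) := hH.comp continuous_neg
    rw [intervalIntegral.integral_add (hH.intervalIntegrable _ _) (hH'.intervalIntegrable _ _),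
      intervalIntegral.integral_comp_neg, neg_neg]
    ring
  have hF' : Continuous fun x => F x + F (-x) := hF.add (hF.comp continuous_neg)
  have hG' : Continuous fun x => G x + G (-x) := hG.add (hG.comp continuous_neg)
  have := intervalIntegral.integral_mono (a := -y) (b := y) (μ := volume) (by linarith)
    (hF'.intervalIntegrable _ _) (hG'.intervalIntegrable _ _) h
  rw [e F hF, e G hG] at this
  linarith

theorem Pskew_minimizes_L2_distance
    (α β : ℝ) (hα : 0 ≤ α) (hβ : 0 ≤ β) (hαβ : 0 < α + β)
    (y : ℝ) (hy : 0 < y) (f₁ f₂ : ℝ → ℝ)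
    (hcont₁ : Continuous f₁) (hcont₂ : Continuous f₂) :
    ∀ g₁ g₂ : ℝ → ℝ, (g₁, g₂) ∈ CskewSet α β →
      Continuous g₁ → Continuous g₂ →
      (∫ x in (-y)..y,
          ((g₁ x - f₁ x) ^ 2 + (g₂ x - f₂ x) ^ 2))
        ≥ ∫ x in (-y)..y,
            (((Pskew α β (f₁, f₂)).1 x - f₁ x) ^ 2
              + ((Pskew α β (f₁, f₂)).2 x - f₂ x) ^ 2) := by
  intro g₁ g₂ hg hg₁ hg₂
  have hD : 0 < α ^ 2 + β ^ 2 := by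
    rcases hα.lt_or_eq with h | h
    · positivity
    · have : 0 < β := by linarith
      positivity
  have hγ : gammaAB α β ^ 2 = 2 * (α ^ 2 + β ^ 2) := by
    unfold gammaAB
    exact Real.sq_sqrt (by positivity)
  apply aux_sym y hy
  · simp only [Pskew, kOne, kTwo, feven, fodd]
    fun_prop
  · fun_prop
  · intro x
    obtain ⟨h1, h2⟩ := hg x
    simp only [Pskew, kOne, kTwo, feven, fodd, hγ, neg_neg] at h1 h2 ⊢
    generalize g₁ x = p at *
    generalize g₁ (-x) = p' at *
    generalize g₂ x = q at *
    generalize g₂ (-x) = q' at *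
    generalize f₁ x = a at *
    generalize f₁ (-x) = a' at *
    generalize f₂ x = b at *
    generalize f₂ (-x) = b' at *
    obtain ⟨t, ht⟩ : ∃ t, t * (α ^ 2 + β ^ 2) = α * ((p - p') / 2) + β * ((q - q') / 2) :=
      ⟨_, div_mul_cancel₀ _ hD.ne'⟩
    obtain ⟨c, hc⟩ : ∃ c, c * (α ^ 2 + β ^ 2) = α * ((a - a') / 2) + β * ((b - b') / 2) :=
      ⟨_, div_mul_cancel₀ _ hD.ne'⟩
    have ho1 : (p - p') / 2 = α * t := by
      apply mul_right_cancel₀ hD.ne'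
      linear_combination β * h2 - α * ht
    have ho2 : (q - q') / 2 = β * t := by
      apply mul_right_cancel₀ hD.ne'
      linear_combination -α * h2 - β * ht
    have k1 : 2 * α / (2 * (α ^ 2 + β ^ 2)) * (α * ((a - a') / 2) + β * ((b - b') / 2))
        = α * c := by
      rw [← hc]; field_simp
    have k2 : 2 * β / (2 * (α ^ 2 + β ^ 2)) * (α * ((a - a') / 2) + β * ((b - b') / 2))
        = β * c := by
      rw [← hc]; field_simp
    have k1' : 2 * α / (2 * (α ^ 2 + β ^ 2)) * (α * ((a' - a) / 2) + β * ((b' - b) / 2))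
        = -(α * c) := by
      rw [← k1]; ring
    have k2' : 2 * β / (2 * (α ^ 2 + β ^ 2)) * (α * ((a' - a) / 2) + β * ((b' - b) / 2))
        = -(β * c) := by
      rw [← k2]; ring
    rw [k1, k2, k1', k2']
    obtain ⟨e, he⟩ : ∃ e, e = (p + p') / 2 := ⟨_, rfl⟩
    obtain rfl : p = e + α * t := by linarith
    obtain rfl : p' = e - α * t := by linarith
    obtain rfl : q = e + β * t := by linarith
    obtain rfl : q' = e - β * t := by linarith
    have n1 : 0 ≤ (α ^ 2 + β ^ 2) * (t - c) ^ 2 := by positivity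
    have n2 := sq_nonneg (e - (a + a' + b + b') / 4)
    clear k1 k2 k1' k2' ht h1 h2 ho1 ho2 he
    have hct : (t - c) * (c * (α ^ 2 + β ^ 2)) = (t - c) * (α * ((a - a') / 2) + β * ((b - b') / 2)) := by rw [hc]
    nlinarith [n1, n2, hct]
end

section
/- Let α, β ≥ 0 with α + β > 0 and let f : ℝ → ℝ be bounded, continuous on ℝ∖{0}, with finite one-sided limits at 0 satisfying lim_{x→0+} f(x) = c and lim_{x→0−} f(x) = −c for some real c, and with finite limits at +∞ and −∞. Then for every ε > 0 there exists N such that for every natural number n ≥ N: (i) for every x > 0, |−f(−x) − 2c·e^{−n(α+β)x} − 2n·∫_0^x e^{−n(α+β)(x−y)}·(β·f(y) − α·f(−y)) dy − Eℓ^weks[α,β]f(x)| ≤ ε; and (ii) for every x < 0, |−f(−x) + 2c·e^{n(α+β)x} + 2n·∫_0^{−x} e^{−n(α+β)(−x−y)}·(β·f(y) − α·f(−y)) dy − Er^weks[α,β]f(x)| ≤ ε. -/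
open MeasureTheory Filter

/-- Left weks extension `Eℓ^weks[α,β]f`. -/
noncomputable def Elweks (α β : ℝ) (f : ℝ → ℝ) (x : ℝ) : ℝ :=
  if x < 0 then f x
  else ((α - β) / (α + β)) * f (-x) - (2 * β / (α + β)) * f x

/-- Right weks extension `Er^weks[α,β]f`. -/
noncomputable def Erweks (α β : ℝ) (f : ℝ → ℝ) (x : ℝ) : ℝ :=
  if x ≤ 0 then -(2 * α / (α + β)) * f x + ((β - α) / (α + β)) * f (-x)
  else f x

lemma weks_kernel_bound (l : ℝ) (hl : 0 < l) (h : ℝ → ℝ) (hc : Continuous h) (η K : ℝ)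
    (hK : 0 ≤ K)
    (hb : ∀ x y, |h x - h y| ≤ η + K * |x - y|) (x : ℝ) (hx : 0 < x) :
    |h x - h 0 * Real.exp (-l * x) - l * ∫ y in (0:ℝ)..x, Real.exp (-l * (x - y)) * h y|
      ≤ η + K / l := by
  have h1 : ∫ y in (0:ℝ)..x, l * Real.exp (-l * (x - y)) = 1 - Real.exp (-l * x) := by
    rw [intervalIntegral.integral_eq_sub_of_hasDerivAt
      (f := fun y => Real.exp (-l * (x - y)))]
    · simp
    · intro y _
      have := (((hasDerivAt_id' y).const_sub x).const_mul (-l)).exp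
      exact this.congr_deriv (by ring)
    · exact Continuous.intervalIntegrable (by fun_prop) _ _
  have h2 : ∫ y in (0:ℝ)..x, l * Real.exp (-l * (x - y)) * (η + K * (x - y))
      = (η + K / l) - Real.exp (-l * x) * (η + K * x + K / l) := by
    rw [intervalIntegral.integral_eq_sub_of_hasDerivAt
      (f := fun y => Real.exp (-l * (x - y)) * (η + K * (x - y) + K / l))]
    · simp
    · intro y _
      have e1 := (((hasDerivAt_id' y).const_sub x).const_mul (-l)).exp
      have e2 := ((((hasDerivAt_id' y).const_sub x).const_mul K).const_add η).add_const (K / l)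
      refine (e1.mul e2).congr_deriv ?_
      field_simp
      ring
    · exact Continuous.intervalIntegrable (by fun_prop) _ _
  have h3 : h x - h 0 * Real.exp (-l * x) - l * ∫ y in (0:ℝ)..x, Real.exp (-l * (x - y)) * h y
      = (h x - h 0) * Real.exp (-l * x)
        + ∫ y in (0:ℝ)..x, l * Real.exp (-l * (x - y)) * (h x - h y) := by
    have : ∫ y in (0:ℝ)..x, l * Real.exp (-l * (x - y)) * (h x - h y)
        = (∫ y in (0:ℝ)..x, l * Real.exp (-l * (x - y))) * h x
          - l * ∫ y in (0:ℝ)..x, Real.exp (-l * (x - y)) * h y := by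
      rw [← intervalIntegral.integral_mul_const, ← intervalIntegral.integral_const_mul,
        ← intervalIntegral.integral_sub]
      · congr 1; ext y; ring
      · exact Continuous.intervalIntegrable (by fun_prop) _ _
      · exact Continuous.intervalIntegrable (by fun_prop) _ _
    rw [this, h1]; ring
  have h4 : |∫ y in (0:ℝ)..x, l * Real.exp (-l * (x - y)) * (h x - h y)|
      ≤ ∫ y in (0:ℝ)..x, l * Real.exp (-l * (x - y)) * (η + K * (x - y)) := by
    refine (intervalIntegral.abs_integral_le_integral_abs hx.le).trans ?_
    apply intervalIntegral.integral_mono_on hx.le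
    · exact Continuous.intervalIntegrable (by fun_prop) _ _
    · exact Continuous.intervalIntegrable (by fun_prop) _ _
    · intro y hy
      have := hb x y
      rw [abs_of_nonneg (sub_nonneg.2 hy.2)] at this
      rw [abs_mul, abs_of_pos (by positivity)]
      gcongr
  have h5 : |(h x - h 0) * Real.exp (-l * x)| ≤ (η + K * x) * Real.exp (-l * x) := by
    have := hb x 0
    rw [sub_zero, abs_of_pos hx] at this
    rw [abs_mul, Real.abs_exp]
    gcongr
  have h6 : 0 ≤ Real.exp (-l * x) * (K / l) := by positivity
  rw [h3]
  refine (abs_add_le _ _).trans ?_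
  rw [h2] at h4
  linarith

lemma weks_uniform (g : ℝ → ℝ) (g0 M L : ℝ) (hM : ∀ x, |g x| ≤ M)
    (hg : ∀ x, 0 < x → ContinuousAt g x)
    (h0 : Tendsto g (nhdsWithin 0 (Set.Ioi 0)) (nhds g0))
    (hL : Tendsto g atTop (nhds L)) (η : ℝ) (hη : 0 < η) :
    ∃ K : ℝ, 0 ≤ K ∧ ∀ l : ℝ, 0 < l → ∀ x : ℝ, 0 < x →
    |g x - g0 * Real.exp (-l * x) - l * ∫ y in (0:ℝ)..x, Real.exp (-l * (x - y)) * g y|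
      ≤ η + K / l := by
  set h : ℝ → ℝ := Function.update (fun y => g |y|) 0 g0 with hh
  have hne : ∀ y, y ≠ 0 → h y = g |y| := fun y hy => by simp [hh, hy]
  have hz : h 0 = g0 := by simp [hh]
  have hc : Continuous h := by
    rw [continuous_iff_continuousAt]
    intro y
    by_cases hy : y = 0
    · subst hy
      rw [hh, continuousAt_update_same]
      refine h0.comp ?_
      exact tendsto_norm_nhdsNE_zero
    · rw [hh, continuousAt_update_of_ne hy]
      exact ContinuousAt.comp (g := g) (hg _ (abs_pos.2 hy)) continuous_abs.continuousAt
  have hu : UniformContinuous h := by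
    refine hc.uniformContinuous_of_tendsto_cocompact (x := L) ?_
    have : Tendsto (fun y : ℝ => g |y|) (cocompact ℝ) (nhds L) :=
      hL.comp (tendsto_norm_cocompact_atTop (E := ℝ))
    refine this.congr' ?_
    have : ({0} : Set ℝ)ᶜ ∈ cocompact ℝ := isCompact_singleton.compl_mem_cocompact
    filter_upwards [this] with y hy
    exact (hne y hy).symm
  have hM0 : 0 ≤ M := (abs_nonneg _).trans (hM 0)
  have hB : ∀ y, |h y| ≤ M + |g0| := by
    intro y
    by_cases hy : y = 0
    · rw [hy, hz]; linarith
    · rw [hne y hy]; have := hM |y|; have := abs_nonneg g0; linarith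
  obtain ⟨δ, hδ, hd⟩ := Metric.uniformContinuous_iff.1 hu η hη
  have hB0 : 0 ≤ M + |g0| := by positivity
  refine ⟨2 * (M + |g0|) / δ, by positivity, ?_⟩
  intro l hl x hx
  have key := weks_kernel_bound l hl h hc η (2 * (M + |g0|) / δ) (by positivity) (by
    intro a b
    by_cases hab : |a - b| < δ
    · have h1 : |h a - h b| < η := hd (a := a) (b := b) hab
      have : 0 ≤ 2 * (M + |g0|) / δ * |a - b| := by positivity
      linarith
    · push Not at hab
      have h1 : |h a - h b| ≤ 2 * (M + |g0|) := by
        have := abs_sub (h a) (h b)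
        linarith [hB a, hB b]
      have h2 : 2 * (M + |g0|) ≤ 2 * (M + |g0|) / δ * |a - b| := by
        rw [div_mul_eq_mul_div, le_div_iff₀ hδ]
        gcongr
      linarith) x hx
  have hI : ∫ y in (0:ℝ)..x, Real.exp (-l * (x - y)) * h y
      = ∫ y in (0:ℝ)..x, Real.exp (-l * (x - y)) * g y := by
    apply intervalIntegral.integral_congr_ae
    refine Eventually.of_forall ?_
    intro y hy
    rw [Set.uIoc_of_le hx.le] at hy
    rw [hne y hy.1.ne', abs_of_pos hy.1]
  rw [hI, hz, hne x hx.ne', abs_of_pos hx] at key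
  exact key

theorem complementary_extensions_tendsto_weks_extensions
    (α β : ℝ) (hα : 0 ≤ α) (hβ : 0 ≤ β) (hαβ : 0 < α + β)
    (f : ℝ → ℝ) (c : ℝ)
    (hbdd : ∃ M : ℝ, ∀ x : ℝ, |f x| ≤ M)
    (hcont : ContinuousOn f {(0 : ℝ)}ᶜ)
    (hlim_right : Tendsto f (nhdsWithin 0 (Set.Ioi 0)) (nhds c))
    (hlim_left : Tendsto f (nhdsWithin 0 (Set.Iio 0)) (nhds (-c)))
    (hlim_top : ∃ Lp : ℝ, Tendsto f atTop (nhds Lp))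
    (hlim_bot : ∃ Lm : ℝ, Tendsto f atBot (nhds Lm)) :
    ∀ ε > 0, ∃ N : ℕ, ∀ n : ℕ, N ≤ n →
      (∀ x : ℝ, 0 < x →
        |(-f (-x) - 2 * c * Real.exp (-(n : ℝ) * (α + β) * x)
            - 2 * (n : ℝ) *
              ∫ y in (0 : ℝ)..x,
                Real.exp (-(n : ℝ) * (α + β) * (x - y)) * (β * f y - α * f (-y)))
          - Elweks α β f x| ≤ ε) ∧
      (∀ x : ℝ, x < 0 →
        |(-f (-x) + 2 * c * Real.exp ((n : ℝ) * (α + β) * x)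
            + 2 * (n : ℝ) *
              ∫ y in (0 : ℝ)..(-x),
                Real.exp (-(n : ℝ) * (α + β) * (-x - y)) * (β * f y - α * f (-y)))
          - Erweks α β f x| ≤ ε) := by
  intro ε hε
  obtain ⟨M, hM⟩ := hbdd
  obtain ⟨Lp, hLp⟩ := hlim_top
  obtain ⟨Lm, hLm⟩ := hlim_bot
  have hfc : ∀ x, x ≠ 0 → ContinuousAt f x := fun x hx =>
    hcont.continuousAt (isOpen_compl_singleton.mem_nhds hx)
  have hneg : Tendsto (fun y : ℝ => -y) (nhdsWithin 0 (Set.Ioi 0)) (nhdsWithin 0 (Set.Iio 0)) := by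
    simpa using tendsto_neg_nhdsGT (a := (0:ℝ))
  obtain ⟨K, hK, hmain⟩ := weks_uniform (fun y => β * f y - α * f (-y)) ((α + β) * c)
    (β * M + α * M) (β * Lp - α * Lm)
    (by
      intro x
      refine (abs_sub _ _).trans ?_
      rw [abs_mul, abs_mul, abs_of_nonneg hα, abs_of_nonneg hβ]
      have := hM x
      have := hM (-x)
      gcongr)
    (by
      intro x hx
      have h1 := hfc x hx.ne'
      have h2 : ContinuousAt (fun y => f (-y)) x :=
        ContinuousAt.comp (g := f) (hfc (-x) (neg_ne_zero.2 hx.ne'))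
          continuous_neg.continuousAt
      exact (h1.const_mul β).sub (h2.const_mul α))
    (by
      have := (hlim_right.const_mul β).sub ((hlim_left.comp hneg).const_mul α)
      rw [show β * c - α * -c = (α + β) * c by ring] at this
      exact this)
    ((hLp.const_mul β).sub ((hLm.comp tendsto_neg_atTop_atBot).const_mul α))
    ((α + β) * ε / 4) (by positivity)
  obtain ⟨N, hN⟩ := exists_nat_gt (4 * K / ((α + β) ^ 2 * ε))
  refine ⟨N + 1, fun n hn => ?_⟩
  have hn1 : (N : ℝ) + 1 ≤ n := by exact_mod_cast hn
  have hn0 : (0 : ℝ) < n := by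
    have : (0 : ℝ) ≤ N := Nat.cast_nonneg N
    linarith
  have hKn : K / (n * (α + β)) ≤ (α + β) * ε / 4 := by
    have h1 : 4 * K / ((α + β) ^ 2 * ε) < n := by linarith
    rw [div_lt_iff₀ (by positivity)] at h1
    rw [div_le_iff₀ (by positivity)]
    nlinarith
  have fin : ∀ x : ℝ, 0 < x → |2 / (α + β) * ((β * f x - α * f (-x))
      - (α + β) * c * Real.exp (-(n : ℝ) * (α + β) * x)
      - n * (α + β) * ∫ y in (0 : ℝ)..x,
          Real.exp (-(n : ℝ) * (α + β) * (x - y)) * (β * f y - α * f (-y)))| ≤ ε := by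
    intro x hx
    have := hmain (n * (α + β)) (by positivity) x hx
    simp only [← neg_mul] at this
    rw [abs_mul, abs_of_pos (by positivity)]
    calc _ ≤ 2 / (α + β) * ((α + β) * ε / 4 + (α + β) * ε / 4) := by
          gcongr
          linarith
      _ = ε := by field_simp; norm_num
  constructor
  · intro x hx
    convert fin x hx using 2
    rw [Elweks, if_neg (not_lt.2 hx.le)]
    generalize (∫ y in (0 : ℝ)..x,
      Real.exp (-(n : ℝ) * (α + β) * (x - y)) * (β * f y - α * f (-y))) = I
    field_simp
    ring
  · intro x hx
    rw [← abs_neg]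
    convert fin (-x) (by linarith) using 2
    rw [Erweks, if_pos hx.le]
    generalize (∫ y in (0 : ℝ)..(-x),
      Real.exp (-(n : ℝ) * (α + β) * (-x - y)) * (β * f y - α * f (-y))) = I
    have : (n : ℝ) * (α + β) * x = -(n : ℝ) * (α + β) * (-x) := by ring
    rw [this, neg_neg]
    field_simp
    ring
end

section
/- Let α, β ≥ 0 with α + β > 0. Then for all functions f₁, f₂ : ℝ → ℝ: (i) P^weks[α,β](f₁,f₂) belongs to 𝒞^weks[α,β]; (ii) P^weks[α,β](f₁,f₂) = (f₁,f₂) if and only if (f₁,f₂) belongs to 𝒞^weks[α,β]. Moreover, (iii) for functions g₁, g₂ : ℝ → ℝ with g₁(0) = −g₂(0), the pair (g₁,g₂) belongs to 𝒞^weks[α,β] if and only if for every x ≠ 0 one has g₁(x) = Eℓ^weks[α,β]f(x) and g₂(x) = Er^weks[α,β]f(x), where f : ℝ → ℝ is defined by f(x) = g₁(x) for x < 0, f(x) = g₂(x) for x > 0, and f(0) = 0. -/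
open MeasureTheory Filter

/-- The weks projection `P^weks[α,β]`. -/
noncomputable def Pweks (α β : ℝ) (p : (ℝ → ℝ) × (ℝ → ℝ)) : (ℝ → ℝ) × (ℝ → ℝ) :=
  (fun x => fodd p.1 x - (2 * α / (gammaAB α β) ^ 2) * kOne α β p.1 p.2 x
      + (1 / 2) * kTwo p.1 p.2 x,
   fun x => fodd p.2 x - (2 * β / (gammaAB α β) ^ 2) * kOne α β p.1 p.2 x
      - (1 / 2) * kTwo p.1 p.2 x)

/-- The space `𝒞^weks[α,β]`. -/
def CweksSet (α β : ℝ) : Set ((ℝ → ℝ) × (ℝ → ℝ)) :=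
  {p | ∀ x : ℝ, feven p.1 x = -feven p.2 x ∧ α * fodd p.1 x = -(β * fodd p.2 x)}

theorem Pweks_is_projection_onto_CweksSet
    (α β : ℝ) (hα : 0 ≤ α) (hβ : 0 ≤ β) (hαβ : 0 < α + β) :
    (∀ f₁ f₂ : ℝ → ℝ, Pweks α β (f₁, f₂) ∈ CweksSet α β) ∧
    (∀ f₁ f₂ : ℝ → ℝ, Pweks α β (f₁, f₂) = (f₁, f₂) ↔ (f₁, f₂) ∈ CweksSet α β) ∧
    (∀ g₁ g₂ : ℝ → ℝ, g₁ 0 = -g₂ 0 →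
      ((g₁, g₂) ∈ CweksSet α β ↔
        (∀ x : ℝ, x ≠ 0 →
          g₁ x = Elweks α β (fun z => if z < 0 then g₁ z else if 0 < z then g₂ z else 0) x ∧
          g₂ x = Erweks α β (fun z => if z < 0 then g₁ z else if 0 < z then g₂ z else 0) x))) := by
  have hs : 0 < α ^ 2 + β ^ 2 := by
    rcases hα.lt_or_eq with h | h
    · positivity
    · have : 0 < β := by linarith
      positivity
  have hg : (gammaAB α β) ^ 2 = 2 * (α ^ 2 + β ^ 2) := by
    unfold gammaAB
    exact Real.sq_sqrt (by positivity)
  have h1 : ∀ f₁ f₂ : ℝ → ℝ, Pweks α β (f₁, f₂) ∈ CweksSet α β := by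
    intro f₁ f₂ x
    simp only [Pweks, hg, kOne, kTwo, feven, fodd, neg_neg]
    constructor
    · ring
    · field_simp
      ring
  refine ⟨h1, ?_, ?_⟩
  · intro f₁ f₂
    constructor
    · intro h
      rw [← h]
      exact h1 f₁ f₂
    · intro h
      have hk : ∀ x, kOne α β f₁ f₂ x = 0 := by
        intro x
        have := (h x).2
        simp only [kOne] at *
        linarith
      refine Prod.ext ?_ ?_ <;> funext x <;>
      · have := (h x).1
        simp only [Pweks, hk, kTwo, feven, fodd] at *
        linarith
  · intro g₁ g₂ h0
    have key : ∀ a b c d : ℝ, ((a + b) / 2 = -((c + d) / 2) ∧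
        α * ((a - b) / 2) = -(β * ((c - d) / 2))) ↔
        (a = (α - β) / (α + β) * b - 2 * β / (α + β) * c ∧
         d = -(2 * α / (α + β)) * b + (β - α) / (α + β) * c) := by
      intro a b c d
      have hne : α + β ≠ 0 := hαβ.ne'
      constructor
      · rintro ⟨e1, e2⟩
        constructor
        · field_simp
          linear_combination 2 * β * e1 + 2 * e2
        · field_simp
          linear_combination 2 * α * e1 - 2 * e2
      · rintro ⟨rfl, rfl⟩
        constructor <;> field_simp <;> ring
    have hpos : ∀ x : ℝ, 0 < x → ((feven g₁ x = -feven g₂ x ∧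
        α * fodd g₁ x = -(β * fodd g₂ x)) ↔
        (g₁ x = (α - β) / (α + β) * g₁ (-x) - 2 * β / (α + β) * g₂ x ∧
         g₂ (-x) = -(2 * α / (α + β)) * g₁ (-x) + (β - α) / (α + β) * g₂ x)) :=
      fun x _ => key _ _ _ _
    constructor
    · intro h x hx
      rcases lt_or_gt_of_ne hx with hx | hx
      · have h2 := (hpos (-x) (by linarith)).1 (h (-x))
        rw [neg_neg] at h2
        simp [Elweks, Erweks, hx, hx.le, not_lt.2 hx.le]
        simpa using h2.2
      · have h2 := (hpos x hx).1 (h x)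
        simp [Elweks, Erweks, hx, not_lt.2 hx.le, not_le.2 hx]
        simpa using h2.1
    · intro h
      have hp : ∀ x : ℝ, 0 < x → (feven g₁ x = -feven g₂ x ∧
          α * fodd g₁ x = -(β * fodd g₂ x)) := by
        intro x hx
        refine (hpos x hx).2 ⟨?_, ?_⟩
        · have := (h x hx.ne').1
          simpa [Elweks, hx, not_lt.2 hx.le] using this
        · have := (h (-x) (by linarith [hx] |> fun (h : -x < 0) => h.ne)).2
          simpa [Erweks, hx, hx.le, not_lt.2 hx.le] using this
      intro x
      rcases lt_trichotomy x 0 with hx | hx | hx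
      · have := hp (-x) (by linarith)
        simp only [feven, fodd, neg_neg] at *
        constructor <;> linarith
      · subst hx
        simp [feven, fodd, h0]
      · exact hp x hx
end

section
/- Let α, β ≥ 0 with α + β > 0. Then for every pair of functions f₁, f₂ : ℝ → ℝ there exists exactly one quadruple of functions (g₁, g₂, h₁, h₂), each ℝ → ℝ, such that (g₁,g₂) ∈ 𝒞^skew[α,β], (h₁,h₂) ∈ 𝒞^weks[α,β], f₁ = g₁ + h₁ and f₂ = g₂ + h₂. -/
open MeasureTheory Filter

theorem direct_sum_decomposition_CskewSet_CweksSet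
    (α β : ℝ) (hα : 0 ≤ α) (hβ : 0 ≤ β) (hαβ : 0 < α + β)
    (f₁ f₂ : ℝ → ℝ) :
    ∃! q : ((ℝ → ℝ) × (ℝ → ℝ)) × ((ℝ → ℝ) × (ℝ → ℝ)),
      q.1 ∈ CskewSet α β ∧ q.2 ∈ CweksSet α β ∧
      f₁ = q.1.1 + q.2.1 ∧ f₂ = q.1.2 + q.2.2 := by
  have hD : 0 < α ^ 2 + β ^ 2 := by
    rcases hα.eq_or_lt with h | h
    · subst h
      have : 0 < β := by linarith
      positivity
    · positivity
  have hD' := hD.ne'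
  let t : ℝ → ℝ := fun x => (α * fodd f₁ x + β * fodd f₂ x) / (α ^ 2 + β ^ 2)
  let e : ℝ → ℝ := fun x => (feven f₁ x + feven f₂ x) / 2
  have ht : ∀ x, t (-x) = - t x := by
    intro x; simp only [t, fodd, neg_neg]; ring
  have he : ∀ x, e (-x) = e x := by
    intro x; simp only [e, feven, neg_neg]; ring
  have htD : ∀ x, (α ^ 2 + β ^ 2) * t x
      = α * ((f₁ x - f₁ (-x)) / 2) + β * ((f₂ x - f₂ (-x)) / 2) := by
    intro x; simp only [t, fodd]; field_simp
  have hee : ∀ x, e x = ((f₁ x + f₁ (-x)) / 2 + (f₂ x + f₂ (-x)) / 2) / 2 := by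
    intro x; simp only [e, feven]
  clear_value t e
  refine ⟨((fun x => e x + α * t x, fun x => e x + β * t x),
    (fun x => f₁ x - (e x + α * t x), fun x => f₂ x - (e x + β * t x))), ⟨?_, ?_, ?_, ?_⟩, ?_⟩
  · intro x
    simp only [feven, fodd, ht, he]
    constructor <;> ring
  · intro x
    simp only [feven, fodd, ht, he]
    constructor
    · linarith [hee x]
    · linarith [htD x]
  · funext x; simp
  · funext x; simp
  · rintro ⟨⟨g₁, g₂⟩, ⟨h₁, h₂⟩⟩ ⟨hg, hh, rfl, rfl⟩
    have key : ∀ x, g₁ x = e x + α * t x ∧ g₂ x = e x + β * t x := by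
      intro x
      obtain ⟨a1, a2⟩ := hg x
      obtain ⟨b1, b2⟩ := hh x
      have c1 := hee x
      have c2 := htD x
      simp only [feven, fodd, Pi.add_apply] at a1 a2 b1 b2 c1 c2
      have d1 : (g₁ x - g₁ (-x)) / 2 = α * t x := by
        apply mul_left_cancel₀ hD'
        linear_combination β * a2 - α * c2 - α * b2
      have d2 : (g₂ x - g₂ (-x)) / 2 = β * t x := by
        apply mul_left_cancel₀ hD'
        linear_combination -α * a2 - β * c2 - β * b2
      constructor <;> linarith
    have k1 : g₁ = fun x => e x + α * t x := funext fun x => (key x).1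
    have k2 : g₂ = fun x => e x + β * t x := funext fun x => (key x).2
    refine Prod.ext (Prod.ext k1 k2) (Prod.ext ?_ ?_)
    · funext x; simp [(key x).1]
    · funext x; simp [(key x).2]
end

section
/- Let a > 0 and let f : ℝ → ℝ be bounded, continuous on ℝ∖{0}, with f(x) → L₊ as x → +∞ and f(x) → L₋ as x → −∞. Then ∫_0^x e^{−a(x−y)}·(f(y) − f(−y)) dy converges to (L₊ − L₋)/a as x → +∞. -/
open MeasureTheory Filter

theorem exp_convolution_limit_at_top
    (a : ℝ) (ha : 0 < a) (f : ℝ → ℝ) (Lp Lm : ℝ)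
    (hbdd : ∃ M : ℝ, ∀ x : ℝ, |f x| ≤ M)
    (hcont : ContinuousOn f {(0 : ℝ)}ᶜ)
    (hlim_top : Tendsto f atTop (nhds Lp))
    (hlim_bot : Tendsto f atBot (nhds Lm)) :
    Tendsto (fun x : ℝ => ∫ y in (0 : ℝ)..x, Real.exp (-a * (x - y)) * (f y - f (-y)))
      atTop (nhds ((Lp - Lm) / a)) := by
  obtain ⟨M, hM⟩ := hbdd
  have hf : Measurable f := measurable_of_continuousOn_compl_singleton 0 hcont
  have hint : IntegrableOn (fun t : ℝ => Real.exp (-a * t)) (Set.Ioi 0) :=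
    integrableOn_exp_mul_Ioi (by linarith) 0
  have hval : ∫ t in Set.Ioi (0:ℝ), Real.exp (-a * t) * (Lp - Lm) = (Lp - Lm) / a := by
    rw [integral_mul_const, integral_exp_mul_Ioi (by linarith) 0]
    simp
    field_simp
  rw [← hval]
  have key : Tendsto (fun x : ℝ => ∫ t in Set.Ioi (0:ℝ), (Set.Iic x).indicator
      (fun t => Real.exp (-a * t) * (f (x - t) - f (-(x - t)))) t) atTop
      (nhds (∫ t in Set.Ioi (0:ℝ), Real.exp (-a * t) * (Lp - Lm))) := by
    apply tendsto_integral_filter_of_dominated_convergence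
      (fun t => Real.exp (-a * t) * (2 * M))
    · refine Eventually.of_forall fun x => ?_
      refine (Measurable.indicator ?_ measurableSet_Iic).aestronglyMeasurable
      fun_prop
    · refine Eventually.of_forall fun x => Eventually.of_forall fun t => ?_
      refine (norm_indicator_le_norm_self _ _).trans ?_
      rw [norm_mul, Real.norm_eq_abs, Real.abs_exp, Real.norm_eq_abs]
      gcongr
      have h1 := abs_le.1 (hM (x - t))
      have h2 := abs_le.1 (hM (-(x - t)))
      exact abs_le.2 ⟨by linarith, by linarith⟩
    · exact hint.mul_const _
    · refine Eventually.of_forall fun t => ?_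
      have h1 : Tendsto (fun x : ℝ => x - t) atTop atTop :=
        tendsto_atTop_add_const_right _ (-t) tendsto_id
      have h2 : Tendsto (fun x : ℝ => -(x - t)) atTop atBot :=
        tendsto_neg_atTop_atBot.comp h1
      refine (((hlim_top.comp h1).sub (hlim_bot.comp h2)).const_mul
        (Real.exp (-a * t))).congr' ?_
      filter_upwards [eventually_ge_atTop t] with x hx
      rw [Set.indicator_of_mem (by exact hx)]
      rfl
  refine key.congr' ?_
  filter_upwards [eventually_ge_atTop 0] with x hx
  rw [setIntegral_indicator measurableSet_Iic, Set.Ioi_inter_Iic,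
    ← intervalIntegral.integral_of_le hx]
  have := intervalIntegral.integral_comp_sub_left (a := 0) (b := x)
    (fun y => Real.exp (-a * (x - y)) * (f y - f (-y))) x
  simpa using this
end
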